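/- Let (u_p)_{p>1} be a family of nodal solutions of (𝒫_p) satisfying condition (A) and the Morse index one hypothesis (M). Then max_Ω u_p → e^{1/2} as p → +∞. If moreover condition (B) holds, then also −min_Ω u_p → e^{1/2} as p → +∞. -/

import Mathlib

open MeasureTheory Real Set Filter Topology Metric

noncomputable section

/-- The Euclidean plane. -/
abbrev R2 : Type := EuclideanSpace ℝ (Fin 2)

/-- The Laplacian: sum of the two pure second directional derivatives. -/
def lap (u : R2 → ℝ) (x : R2) : ℝ :=
  ∑ i : Fin 2,
    fderiv ℝ (fun y => fderiv ℝ u y (EuclideanSpace.single i 1)) x (EuclideanSpace.single i 1)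

/-- Each point of ∂Ω has a neighborhood in which ∂Ω is the graph of a C^∞ function
(in suitable Euclidean coordinates). -/
def SmoothBoundary (Ω : Set R2) : Prop :=
  ∀ x ∈ frontier Ω, ∃ V : Set R2, IsOpen V ∧ x ∈ V ∧
    ∃ (e : R2 ≃ᵢ R2) (g : ℝ → ℝ), ContDiff ℝ (⊤ : ℕ∞) g ∧
      frontier Ω ∩ V = {y | y ∈ V ∧ e y 1 = g (e y 0)}

/-- A (classical) solution of the Lane–Emden problem `(𝒫_p)` on Ω. -/
def IsSolution (Ω : Set R2) (p : ℝ) (u : R2 → ℝ) : Prop :=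
  ContDiffOn ℝ 2 u Ω ∧ ContDiffOn ℝ 1 u (closure Ω) ∧
  (∀ x ∈ Ω, -lap u x = |u x| ^ (p - 1) * u x) ∧
  (∀ x ∈ frontier Ω, u x = 0)

/-- A nodal (sign-changing) function on Ω. -/
def IsNodal (Ω : Set R2) (u : R2 → ℝ) : Prop :=
  (∃ x ∈ Ω, 0 < u x) ∧ ∃ x ∈ Ω, u x < 0

/-- The energy functional E_p. -/
def energy (Ω : Set R2) (p : ℝ) (u : R2 → ℝ) : ℝ :=
  (1 / 2) * ∫ x in Ω, ‖gradient u x‖ ^ 2 - (1 / (p + 1)) * ∫ x in Ω, |u x| ^ (p + 1)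

/-- Condition (A): p·∫_Ω |∇u_p|² → 16πe. -/
def CondA (Ω : Set R2) (u : ℝ → R2 → ℝ) : Prop :=
  Tendsto (fun p : ℝ => p * ∫ x in Ω, ‖gradient (u p) x‖ ^ 2) atTop
    (𝓝 (16 * π * Real.exp 1))

/-- Condition (B): p·(u_p(x_p⁺) + u_p(x_p⁻)) → K for some K ≥ 0. -/
def CondB (u : ℝ → R2 → ℝ) (xp xm : ℝ → R2) : Prop :=
  ∃ K : ℝ, 0 ≤ K ∧ Tendsto (fun p : ℝ => p * (u p (xp p) + u p (xm p))) atTop (𝓝 K)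

/-- ε_p := (p·u_p(x_p⁺)^{p−1})^{−1/2}. -/
def eps (u : ℝ → R2 → ℝ) (xp : ℝ → R2) (p : ℝ) : ℝ :=
  1 / Real.sqrt (p * u p (xp p) ^ (p - 1))

/-- The rescaling z_p of u_p around x_p⁺. -/
def zp (u : ℝ → R2 → ℝ) (xp : ℝ → R2) (p : ℝ) (x : R2) : ℝ :=
  (p / u p (xp p)) * (u p (eps u xp p • x + xp p) - u p (xp p))

/-- The rescaling z_p⁻ of u_p around x_p⁻ (with the scale ε_p of the maximum). -/
def zm (u : ℝ → R2 → ℝ) (xp xm : ℝ → R2) (p : ℝ) (x : R2) : ℝ :=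
  (p / u p (xp p)) * (-u p (eps u xp p • x + xm p) - u p (xp p))

/-- Convergence in C²_loc(ℝ²) of a family of functions f_i defined on sets D_i:
every compact set K is eventually contained in D_i, and on K all derivatives up to
order 2 converge uniformly. -/
def TendstoC2loc {ι : Type} (l : Filter ι) (D : ι → Set R2) (f : ι → R2 → ℝ)
    (g : R2 → ℝ) : Prop :=
  ∀ K : Set R2, IsCompact K →
    (∀ᶠ i in l, K ⊆ D i) ∧
    ∀ n : ℕ, n ≤ 2 →
      TendstoUniformlyOn (fun i x => iteratedFDeriv ℝ n (f i) x)
        (fun x => iteratedFDeriv ℝ n g x) l K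

/-- The standard bubble U(x) = −2 log(1 + |x|²/8). -/
def stdBubble (x : R2) : ℝ := -2 * Real.log (1 + ‖x‖ ^ 2 / 8)

/-- The bubble U_μ(x) = log(μ/(1 + μ|x|²/8)²). -/
def bubble (μ : ℝ) (x : R2) : ℝ := Real.log (μ / (1 + μ * ‖x‖ ^ 2 / 8) ^ 2)

/-- A C^∞ function compactly supported in S. -/
def CcSmoothIn (S : Set R2) (v : R2 → ℝ) : Prop :=
  ContDiff ℝ (⊤ : ℕ∞) v ∧ HasCompactSupport v ∧ tsupport v ⊆ S

/-- The quadratic form of the linearized operator at u. -/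
def Qform (p : ℝ) (u v : R2 → ℝ) : ℝ :=
  ∫ x, (‖gradient v x‖ ^ 2 - p * |u x| ^ (p - 1) * v x ^ 2)

/-- Morse index one hypothesis (M): for p large, the quadratic form of the linearized
operator is negative somewhere on C_c^∞ of the positive nodal domain, but is not
negative definite on any 2-dimensional subspace. -/
def MorseOne (Ω : Set R2) (u : ℝ → R2 → ℝ) : Prop :=
  ∀ᶠ p : ℝ in atTop,
    (∃ v : R2 → ℝ, CcSmoothIn {x ∈ Ω | 0 < u p x} v ∧ Qform p (u p) v < 0) ∧
    ¬ ∃ v w : R2 → ℝ, CcSmoothIn {x ∈ Ω | 0 < u p x} v ∧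
        CcSmoothIn {x ∈ Ω | 0 < u p x} w ∧
        LinearIndependent ℝ ![v, w] ∧
        ∀ a b : ℝ, ¬(a = 0 ∧ b = 0) →
          Qform p (u p) (fun x => a * v x + b * w x) < 0

theorem volume_add_volume_le_of_isCompact {K L C : Set ℝ} (hK : IsCompact K) (hL : IsCompact L)
    (hKn : K.Nonempty) (hLn : L.Nonempty) (hC : ∀ s ∈ K, ∀ t ∈ L, s + t ∈ C) :
    volume K + volume L ≤ volume C := by
  obtain ⟨m, hm, hmK⟩ := hK.exists_isGreatest hKn
  obtain ⟨l, hl, hlL⟩ := hL.exists_isLeast hLn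
  set K' := (fun x : ℝ => x - l) ⁻¹' K
  set L' := (fun x : ℝ => x - m) ⁻¹' L
  have h1 : volume K' = volume K :=
    (measurePreserving_sub_right volume l).measure_preimage hK.measurableSet.nullMeasurableSet
  have h2 : volume L' = volume L :=
    (measurePreserving_sub_right volume m).measure_preimage hL.measurableSet.nullMeasurableSet
  have hL'm : MeasurableSet L' := hL.measurableSet.preimage (by fun_prop)
  have h3 : K' ∩ L' ⊆ {m + l} := by
    rintro x ⟨hx1, hx2⟩
    have a := hmK hx1
    have b := hlL hx2
    simp only [mem_singleton_iff]
    linarith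
  have h4 : volume (K' ∩ L') = 0 := measure_mono_null h3 (by simp)
  have h5 : K' ∪ L' ⊆ C := by
    rintro x (hx | hx)
    · simpa using hC _ hx _ hl
    · simpa using hC _ hm _ hx
  calc volume K + volume L = volume (K' ∪ L') + volume (K' ∩ L') := by
        rw [measure_union_add_inter _ hL'm, h1, h2]
    _ ≤ volume C := by rw [h4, add_zero]; exact measure_mono h5

/-- The one-dimensional Brunn–Minkowski inequality. -/
theorem volume_add_volume_le {S T C : Set ℝ} (hS : MeasurableSet S) (hT : MeasurableSet T)
    (hSn : S.Nonempty) (hTn : T.Nonempty) (hC : ∀ s ∈ S, ∀ t ∈ T, s + t ∈ C) :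
    volume S + volume T ≤ volume C := by
  obtain ⟨s₀, hs₀⟩ := hSn
  obtain ⟨t₀, ht₀⟩ := hTn
  have key : ∀ K ⊆ S, IsCompact K → ∀ L ⊆ T, IsCompact L → volume K + volume L ≤ volume C := by
    intro K hKS hK L hLT hL
    refine le_trans (add_le_add (measure_mono (subset_insert s₀ K))
      (measure_mono (subset_insert t₀ L))) (volume_add_volume_le_of_isCompact (hK.insert _)
      (hL.insert _) (insert_nonempty _ _) (insert_nonempty _ _) ?_)
    intro s hs t ht
    exact hC s (insert_subset hs₀ hKS hs) t (insert_subset ht₀ hLT ht)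
  have sup : ∀ {D : Set ℝ}, MeasurableSet D →
      volume D = ⨆ K, ⨆ (_ : K ⊆ D ∧ IsCompact K), volume K := fun hD => by
    simp_rw [iSup_and]
    exact hD.measure_eq_iSup_isCompact volume
  rw [sup hS, sup hT]
  exact ENNReal.biSup_add_biSup_le' ⟨∅, by simp⟩ ⟨∅, by simp⟩
    fun K hK L hL => key K hK.1 hK.2 L hL.1 hL.2

theorem exists_volume_section_le {A : Set (ℝ × ℝ)} (hA : Bornology.IsBounded A) :
    ∃ R : ℝ, 0 ≤ R ∧ ∀ x : ℝ, volume (Prod.mk x ⁻¹' A) ≤ ENNReal.ofReal R := by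
  obtain ⟨r, hr⟩ := hA.subset_closedBall 0
  refine ⟨2 * max r 0, by positivity, fun x => ?_⟩
  have : Prod.mk x ⁻¹' A ⊆ Icc (-(max r 0)) (max r 0) := by
    intro y hy
    have := hr hy
    rw [mem_closedBall, dist_zero_right, Prod.norm_def] at this
    have h2 : |y| ≤ r := le_trans (le_max_right _ _) this
    exact abs_le.1 (h2.trans (le_max_left _ _))
  refine (measure_mono this).trans ?_
  rw [Real.volume_Icc]
  exact ENNReal.ofReal_le_ofReal (by linarith)

theorem volume_eq_lintegral_ofReal_section {A : Set (ℝ × ℝ)} (hAm : MeasurableSet A)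
    (hA : Bornology.IsBounded A) :
    volume A = ∫⁻ x, ENNReal.ofReal (volume (Prod.mk x ⁻¹' A)).toReal := by
  obtain ⟨R, -, hR⟩ := exists_volume_section_le hA
  rw [Measure.volume_eq_prod, Measure.prod_apply hAm]
  refine lintegral_congr fun x => ?_
  rw [ENNReal.ofReal_toReal ((hR x).trans_lt ENNReal.ofReal_lt_top).ne]

theorem lintegral_ofReal_eq_of_le {α : Type*} [MeasurableSpace α] {μ : Measure α} {f : α → ℝ}
    {H : ℝ} (hH : 0 < H) (hf : Measurable f) (h0 : ∀ x, 0 ≤ f x) (h1 : ∀ x, f x ≤ H) :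
    ∫⁻ x, ENNReal.ofReal (f x) ∂μ = ∫⁻ t in Ioo (0 : ℝ) H, μ {x | t < f x} := by
  rw [lintegral_eq_lintegral_meas_lt μ (ae_of_all _ h0) hf.aemeasurable]
  rw [← Ioo_union_Ici_eq_Ioi hH, lintegral_union measurableSet_Ici]
  · rw [setLIntegral_congr_fun (g := fun _ => 0) measurableSet_Ici]
    · simp
    · intro t ht
      have : {x | t < f x} = ∅ := by
        ext x
        simpa using (h1 x).trans ht
      simp [this]
  · exact Set.disjoint_left.2 fun x hx hx' => not_lt.2 hx' hx.2

/-- The Brunn–Minkowski inequality in the plane. -/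
theorem brunn_minkowski_prod {A B C : Set (ℝ × ℝ)} (hA : MeasurableSet A) (hB : MeasurableSet B)
    (hC : MeasurableSet C) (hAb : Bornology.IsBounded A) (hBb : Bornology.IsBounded B)
    (hCb : Bornology.IsBounded C) (hA0 : volume A ≠ 0) (hB0 : volume B ≠ 0)
    (h : ∀ a ∈ A, ∀ b ∈ B, a + b ∈ C) :
    (√(volume.real A) + √(volume.real B)) ^ 2 ≤ volume.real C := by
  set f : ℝ → ℝ := fun x => (volume (Prod.mk x ⁻¹' A)).toReal with hf
  set g : ℝ → ℝ := fun x => (volume (Prod.mk x ⁻¹' B)).toReal with hg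
  set k : ℝ → ℝ := fun x => (volume (Prod.mk x ⁻¹' C)).toReal with hk
  have mf : Measurable f := (measurable_measure_prodMk_left hA).ennreal_toReal
  have mg : Measurable g := (measurable_measure_prodMk_left hB).ennreal_toReal
  have mk : Measurable k := (measurable_measure_prodMk_left hC).ennreal_toReal
  have bdd : ∀ {D : Set (ℝ × ℝ)}, Bornology.IsBounded D →
      BddAbove (range fun x => (volume (Prod.mk x ⁻¹' D)).toReal) := by
    intro D hD
    obtain ⟨R, hR0, hR⟩ := exists_volume_section_le hD
    refine ⟨R, ?_⟩
    rintro _ ⟨x, rfl⟩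
    exact ENNReal.toReal_le_of_le_ofReal hR0 (hR x)
  have pos : ∀ {D : Set (ℝ × ℝ)}, MeasurableSet D → Bornology.IsBounded D → volume D ≠ 0 →
      0 < ⨆ x, (volume (Prod.mk x ⁻¹' D)).toReal := by
    intro D hDm hD hD0
    by_contra! hle
    apply hD0
    rw [volume_eq_lintegral_ofReal_section hDm hD]
    refine (lintegral_congr fun x => ?_).trans lintegral_zero
    exact ENNReal.ofReal_of_nonpos ((le_ciSup (bdd hD) x).trans hle)
  set a := ⨆ x, f x with ha
  set b := ⨆ x, g x with hb
  have a0 : 0 < a := pos hA hAb hA0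
  have b0 : 0 < b := pos hB hBb hB0
  have fa : ∀ x, f x ≤ a := le_ciSup (bdd hAb)
  have gb : ∀ x, g x ≤ b := le_ciSup (bdd hBb)
  have f0 : ∀ x, 0 ≤ f x := fun x => ENNReal.toReal_nonneg
  have g0 : ∀ x, 0 ≤ g x := fun x => ENNReal.toReal_nonneg
  have k0 : ∀ x, 0 ≤ k x := fun x => ENNReal.toReal_nonneg
  have finsec : ∀ {D : Set (ℝ × ℝ)}, Bornology.IsBounded D → ∀ x,
      volume (Prod.mk x ⁻¹' D) ≠ ⊤ := fun hD x => by
    obtain ⟨R, -, hR⟩ := exists_volume_section_le hD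
    exact ((hR x).trans_lt ENNReal.ofReal_lt_top).ne
  have sec : ∀ x y, 0 < f x → 0 < g y → f x + g y ≤ k (x + y) := by
    intro x y hx hy
    have := volume_add_volume_le (S := Prod.mk x ⁻¹' A) (T := Prod.mk y ⁻¹' B)
      (C := Prod.mk (x + y) ⁻¹' C) (hA.preimage (by fun_prop)) (hB.preimage (by fun_prop))
      (nonempty_of_measure_ne_zero (μ := volume) (ENNReal.toReal_pos_iff.1 hx).1.ne')
      (nonempty_of_measure_ne_zero (μ := volume) (ENNReal.toReal_pos_iff.1 hy).1.ne')
      (fun s hs t ht => by simpa using h _ hs _ ht)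
    have h2 := ENNReal.toReal_mono (finsec hCb _) this
    rwa [ENNReal.toReal_add (finsec hAb _) (finsec hBb _)] at h2
  have norm : ∀ (D : Set (ℝ × ℝ)), MeasurableSet D → Bornology.IsBounded D → ∀ c : ℝ, 0 < c →
      volume.real D = c * (∫⁻ x, ENNReal.ofReal ((volume (Prod.mk x ⁻¹' D)).toReal / c)).toReal := by
    intro D hDm hD c hc
    rw [measureReal_def, volume_eq_lintegral_ofReal_section hDm hD]
    simp_rw [div_eq_mul_inv]
    rw [lintegral_congr fun x => ENNReal.ofReal_mul' (inv_nonneg.2 hc.le),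
      lintegral_mul_const' _ _ ENNReal.ofReal_ne_top, ENNReal.toReal_mul,
      ENNReal.toReal_ofReal (inv_nonneg.2 hc.le)]
    field_simp
  have hfin : ∀ (D : Set (ℝ × ℝ)), MeasurableSet D → Bornology.IsBounded D → ∀ c : ℝ, 0 < c →
      ∫⁻ x, ENNReal.ofReal ((volume (Prod.mk x ⁻¹' D)).toReal / c) ≠ ⊤ := by
    intro D hDm hD c hc
    simp_rw [div_eq_mul_inv]
    rw [lintegral_congr fun x => ENNReal.ofReal_mul' (inv_nonneg.2 hc.le),
      lintegral_mul_const' _ _ ENNReal.ofReal_ne_top, ← volume_eq_lintegral_ofReal_section hDm hD]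
    exact ENNReal.mul_ne_top hD.measure_lt_top.ne ENNReal.ofReal_ne_top
  have main : (∫⁻ x, ENNReal.ofReal (f x / a)) + (∫⁻ x, ENNReal.ofReal (g x / b))
      ≤ ∫⁻ x, ENNReal.ofReal (k x / (a + b)) := by
    rw [lintegral_ofReal_eq_of_le one_pos (mf.div_const a) (fun x => div_nonneg (f0 x) a0.le)
      (fun x => (div_le_one a0).2 (fa x)),
      lintegral_ofReal_eq_of_le one_pos (mg.div_const b) (fun x => div_nonneg (g0 x) b0.le)
      (fun x => (div_le_one b0).2 (gb x)),
      lintegral_eq_lintegral_meas_lt volume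
        (ae_of_all _ fun x => div_nonneg (k0 x) (add_pos a0 b0).le) (mk.div_const _).aemeasurable]
    refine le_trans ?_ (lintegral_mono_set (Ioo_subset_Ioi_self (a := (1 : ℝ)) (b := 0)))
    rw [← lintegral_add_left]
    · refine setLIntegral_mono' measurableSet_Ioo fun t ht => ?_
      refine volume_add_volume_le (measurableSet_lt measurable_const (mf.div_const a))
        (measurableSet_lt measurable_const (mg.div_const b)) ?_ ?_ ?_
      · obtain ⟨x, hx⟩ := exists_lt_of_lt_ciSup (show t * a < ⨆ x, f x from by
          rw [← ha]; nlinarith [ht.2])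
        exact ⟨x, (lt_div_iff₀ a0).2 hx⟩
      · obtain ⟨x, hx⟩ := exists_lt_of_lt_ciSup (show t * b < ⨆ x, g x from by
          rw [← hb]; nlinarith [ht.2])
        exact ⟨x, (lt_div_iff₀ b0).2 hx⟩
      · intro x hx y hy
        simp only [mem_ofPred_eq] at hx hy ⊢
        rw [lt_div_iff₀ a0] at hx
        rw [lt_div_iff₀ b0] at hy
        rw [lt_div_iff₀ (add_pos a0 b0)]
        have h1 := mul_pos ht.1 a0
        have h2 := mul_pos ht.1 b0
        have := sec x y (h1.trans hx) (h2.trans hy)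
        linarith
    · exact Antitone.measurable fun s t hst => measure_mono fun x hx => lt_of_le_of_lt hst hx
  have hab : 0 < a + b := add_pos a0 b0
  have main' := ENNReal.toReal_mono (hfin C hC hCb _ hab) main
  rw [ENNReal.toReal_add (hfin A hA hAb _ a0) (hfin B hB hBb _ b0)] at main'
  have eA := norm A hA hAb a a0
  have eB := norm B hB hBb b b0
  have eC := norm C hC hCb _ hab
  set α := (∫⁻ x, ENNReal.ofReal (f x / a)).toReal
  set β := (∫⁻ x, ENNReal.ofReal (g x / b)).toReal
  have α0 : 0 ≤ α := ENNReal.toReal_nonneg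
  have β0 : 0 ≤ β := ENNReal.toReal_nonneg
  rw [eA, eB, eC, Real.sqrt_mul a0.le, Real.sqrt_mul b0.le]
  refine le_trans ?_ (mul_le_mul_of_nonneg_left main' hab.le)
  have q1 := Real.sq_sqrt a0.le
  have q2 := Real.sq_sqrt b0.le
  have q3 := Real.sq_sqrt α0
  have q4 := Real.sq_sqrt β0
  nlinarith [sq_nonneg (√a * √β - √b * √α)]

theorem measurePreserving_toLp_pair :
    MeasurePreserving (fun q : ℝ × ℝ => (!₂[q.1, q.2] : R2)) := by
  exact (PiLp.volume_preserving_toLp (Fin 2)).comp (volume_preserving_finTwoArrow ℝ).symm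

theorem isBounded_preimage_toLp_pair {A : Set R2} (hA : Bornology.IsBounded A) :
    Bornology.IsBounded ((fun q : ℝ × ℝ => (!₂[q.1, q.2] : R2)) ⁻¹' A) := by
  obtain ⟨r, hr⟩ := hA.subset_closedBall 0
  refine isBounded_closedBall.subset (t := closedBall (0 : ℝ × ℝ) r) fun q hq => ?_
  have h := hr hq
  rw [mem_closedBall, dist_zero_right] at h ⊢
  rw [Prod.norm_def]
  refine max_le ?_ ?_
  · simpa using (PiLp.norm_apply_le (!₂[q.1, q.2] : R2) 0).trans h
  · simpa using (PiLp.norm_apply_le (!₂[q.1, q.2] : R2) 1).trans h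

/-- The Brunn–Minkowski inequality for the sum of a plane set and a disc. -/
theorem brunn_minkowski_ball {A C : Set R2} (hA : MeasurableSet A) (hC : MeasurableSet C)
    (hAb : Bornology.IsBounded A) (hCb : Bornology.IsBounded C) (hA0 : volume A ≠ 0)
    {r : ℝ} (hr : 0 < r) (h : ∀ a ∈ A, ∀ y, ‖y‖ < r → a + y ∈ C) :
    (√(volume.real A) + √π * r) ^ 2 ≤ volume.real C := by
  have mp := measurePreserving_toLp_pair
  have hvol : ∀ {D : Set R2}, MeasurableSet D →
      volume ((fun q : ℝ × ℝ => (!₂[q.1, q.2] : R2)) ⁻¹' D) = volume D := fun hD =>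
    mp.measure_preimage hD.nullMeasurableSet
  have hB0 : volume (ball (0 : R2) r) ≠ 0 := (measure_ball_pos _ _ hr).ne'
  have key := brunn_minkowski_prod (mp.measurable hA) (mp.measurable (measurableSet_ball (x := (0 : R2)) (ε := r)))
    (mp.measurable hC) (isBounded_preimage_toLp_pair hAb)
    (isBounded_preimage_toLp_pair isBounded_ball) (isBounded_preimage_toLp_pair hCb)
    (by rwa [hvol hA]) (by rwa [hvol measurableSet_ball]) (by
      intro a ha b hb
      have := h _ ha _ (by simpa using hb)
      have e : (!₂[a.1, a.2] : R2) + !₂[b.1, b.2] = !₂[(a + b).1, (a + b).2] := by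
        ext i
        fin_cases i <;> simp
      rwa [e] at this)
  have hball : √(volume.real (ball (0 : R2) r)) = √π * r := by
    rw [measureReal_def, EuclideanSpace.volume_ball_fin_two, mul_comm, ENNReal.toReal_mul,
      ENNReal.toReal_pow, ENNReal.toReal_ofReal hr.le, Real.sqrt_mul (by simp),
      Real.sqrt_sq hr.le]
    simp [ENNReal.toReal_ofReal Real.pi_pos.le]
  simp only [measureReal_def, hvol hA, hvol hC, hvol measurableSet_ball] at key hball ⊢
  rwa [hball] at key

theorem isoperimetric_of_contDiff {v : R2 → ℝ} (hv : ContDiff ℝ 1 v) (hc : HasCompactSupport v)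
    {H : ℝ} (hH : 0 < H) (h0 : ∀ x, 0 ≤ v x) (h1 : ∀ x, v x ≤ H) :
    2 * √π * H * √(volume.real {x | H ≤ v x}) ≤ ∫ x, ‖fderiv ℝ v x‖ := by
  set m := volume.real {x | H ≤ v x} with hm
  have int0 : 0 ≤ ∫ x, ‖fderiv ℝ v x‖ := integral_nonneg fun _ => norm_nonneg _
  rcases eq_or_ne m 0 with h | hm0
  · simpa [h] using int0
  have cD : Continuous (fderiv ℝ v) := hv.continuous_fderiv one_ne_zero
  have cv : Continuous v := hv.continuous
  have sD : HasCompactSupport (fderiv ℝ v) := hc.fderiv ℝ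
  have iD : Integrable (fun x => ‖fderiv ℝ v x‖) := (cD.integrable_of_hasCompactSupport sD).norm
  have iv : Integrable v := cv.integrable_of_hasCompactSupport hc
  set K := cthickening 1 (tsupport v) with hK
  have cK : IsCompact K := IsCompact.cthickening hc
  have mK : MeasurableSet K := cK.measurableSet
  have step : ∀ ε > 0, 2 * √π * H * √m ≤ (∫ x, ‖fderiv ℝ v x‖) + ε * volume.real K := by
    intro ε hε
    obtain ⟨δ, hδ, hδ'⟩ := Metric.uniformContinuous_iff.1
      (sD.uniformContinuous_of_continuous cD) ε hε
    set r := min δ 1 with hr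
    have r0 : 0 < r := lt_min hδ one_pos
    set g : R2 → ℝ := fun z => v z + r * (‖fderiv ℝ v z‖ + K.indicator (fun _ => ε) z) with hg
    have mg : Measurable g := by
      have : Measurable (K.indicator (fun _ => ε)) := measurable_const.indicator mK
      exact cv.measurable.add (((cD.norm.measurable).add this).const_mul r)
    have iK : Integrable (K.indicator (fun _ => ε)) :=
      (integrable_indicator_iff mK).2 (integrableOn_const cK.measure_lt_top.ne)
    have ig : Integrable g := iv.add ((iD.add iK).const_mul r)
    have g0 : ∀ z, 0 ≤ g z := fun z => add_nonneg (h0 z) (mul_nonneg r0.le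
      (add_nonneg (norm_nonneg _) (indicator_nonneg (fun _ _ => hε.le) _)))
    have hgK : ∀ z ∉ K, g z = 0 := by
      intro z hz
      have hz' : z ∉ tsupport v := fun h => hz (self_subset_cthickening _ h)
      simp only [hg, indicator_of_notMem hz, image_eq_zero_of_notMem_tsupport hz',
        image_eq_zero_of_notMem_tsupport fun h => hz' (tsupport_fderiv_subset ℝ h)]
      simp
    have shift : ∀ t ≥ 0, ∀ a ∈ {x | t < v x}, ∀ y : R2, ‖y‖ < r → a + y ∈ {x | t < g x} := by
      intro t ht a ha y hy
      set z := a + y with hz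
      have hzK : z ∈ K := by
        refine mem_cthickening_of_dist_le z a 1 _ (subset_tsupport _ ?_) ?_
        · exact (lt_of_le_of_lt ht ha).ne'
        · simpa [hz] using hy.le.trans (min_le_right _ _)
      have hmv : ‖v a - v z‖ ≤ (‖fderiv ℝ v z‖ + ε) * ‖a - z‖ := by
        refine (convex_ball z r).norm_image_sub_le_of_norm_fderiv_le (𝕜 := ℝ)
          (fun x _ => hv.differentiable one_ne_zero x) ?_ (mem_ball_self r0) ?_
        · intro x hx
          have := hδ' (lt_of_lt_of_le (mem_ball.1 hx) (min_le_left _ _))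
          rw [dist_eq_norm] at this
          have := norm_sub_norm_le (fderiv ℝ v x) (fderiv ℝ v z)
          linarith
        · simpa [hz, dist_eq_norm] using hy
      have haz : ‖a - z‖ ≤ r := by simpa [hz] using hy.le
      have h3 : v a - v z ≤ (‖fderiv ℝ v z‖ + ε) * r :=
        (le_abs_self _).trans (hmv.trans (mul_le_mul_of_nonneg_left haz (by positivity)))
      simp only [mem_ofPred_eq] at ha ⊢
      simp only [hg, indicator_of_mem hzK]
      linarith
    have level : ∀ t ∈ Ioo 0 H, volume {x | t < v x} + ENNReal.ofReal (2 * √π * r * √m)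
        ≤ volume {x | t < g x} := by
      intro t ht
      have sub : {x | H ≤ v x} ⊆ {x | t < v x} := fun x hx => lt_of_lt_of_le ht.2 hx
      have bA : {x | t < v x} ⊆ tsupport v := fun x hx =>
        subset_tsupport _ (ht.1.trans hx).ne'
      have bC : {x | t < g x} ⊆ K := fun x hx => by
        by_contra hxK
        have : t < g x := hx
        rw [hgK x hxK] at this
        exact lt_asymm this ht.1
      have fA : volume {x | t < v x} ≠ ⊤ := ((measure_mono bA).trans_lt hc.measure_lt_top).ne
      have fC : volume {x | t < g x} ≠ ⊤ := ((measure_mono bC).trans_lt cK.measure_lt_top).ne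
      have hmle : m ≤ volume.real {x | t < v x} := measureReal_mono sub fA
      have bm := brunn_minkowski_ball (measurableSet_lt measurable_const cv.measurable)
        (measurableSet_lt measurable_const mg) (hc.isBounded.subset bA) (cK.isBounded.subset bC)
        (fun h => hm0 (le_antisymm (hmle.trans (by simp [measureReal_def, h])) measureReal_nonneg))
        r0 (shift t ht.1.le)
      rw [← ENNReal.ofReal_toReal fA, ← ENNReal.ofReal_toReal fC,
        ← ENNReal.ofReal_add ENNReal.toReal_nonneg (by positivity)]
      refine ENNReal.ofReal_le_ofReal (le_trans ?_ bm)
      have s1 := Real.sq_sqrt (measureReal_nonneg (μ := volume) (s := {x | t < v x}))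
      have s2 := Real.sqrt_le_sqrt hmle
      have s3 : 0 ≤ √π * r := by positivity
      rw [← measureReal_def]
      nlinarith [mul_le_mul_of_nonneg_left s2 s3, sq_nonneg (√π * r)]
    have total : ENNReal.ofReal (∫ x, v x) + ENNReal.ofReal (2 * √π * r * √m) * ENNReal.ofReal H
        ≤ ENNReal.ofReal (∫ x, g x) := by
      rw [ofReal_integral_eq_lintegral_ofReal iv (ae_of_all _ h0),
        ofReal_integral_eq_lintegral_ofReal ig (ae_of_all _ g0),
        lintegral_ofReal_eq_of_le hH cv.measurable h0 h1,
        lintegral_eq_lintegral_meas_lt _ (ae_of_all _ g0) mg.aemeasurable]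
      have : ENNReal.ofReal (2 * √π * r * √m) * ENNReal.ofReal H
          = ∫⁻ t in Ioo 0 H, ENNReal.ofReal (2 * √π * r * √m) := by
        simp
      rw [this, ← lintegral_add_right _ measurable_const]
      exact (setLIntegral_mono' measurableSet_Ioo level).trans
        (lintegral_mono_set (Ioo_subset_Ioi_self (a := H) (b := 0)))
    rw [← ENNReal.ofReal_mul (by positivity), ← ENNReal.ofReal_add (integral_nonneg h0)
      (by positivity), ENNReal.ofReal_le_ofReal_iff (integral_nonneg g0)] at total
    have eg : ∫ x, g x = (∫ x, v x) + r * ((∫ x, ‖fderiv ℝ v x‖) + ε * volume.real K) := by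
      simp only [hg]
      have iDK : Integrable fun z => ‖fderiv ℝ v z‖ + K.indicator (fun _ => ε) z := iD.add iK
      rw [integral_add iv (iDK.const_mul r), integral_const_mul, integral_add iD iK,
        integral_indicator mK]
      simp [mul_comm]
    rw [eg] at total
    have : r * (2 * √π * H * √m) ≤ r * ((∫ x, ‖fderiv ℝ v x‖) + ε * volume.real K) := by
      linarith
    exact le_of_mul_le_mul_left this r0
  refine le_of_forall_pos_le_add fun ε hε => ?_
  have hK1 : 0 < volume.real K + 1 := by positivity
  refine (step (ε / (volume.real K + 1)) (by positivity)).trans ?_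
  gcongr
  rw [div_mul_eq_mul_div, div_le_iff₀ hK1]
  nlinarith

theorem norm_gradient_eq (f : R2 → ℝ) (x : R2) : ‖gradient f x‖ = ‖fderiv ℝ f x‖ :=
  LinearIsometryEquiv.norm_map _ _

theorem norm_gradient_sq_eq (f : R2 → ℝ) (x : R2) :
    ‖gradient f x‖ ^ 2 = ∑ i : Fin 2, fderiv ℝ f x (EuclideanSpace.single i 1) ^ 2 := by
  rw [EuclideanSpace.norm_sq_eq]
  refine Finset.sum_congr rfl fun i _ => ?_
  have h : fderiv ℝ f x (EuclideanSpace.single i 1) = gradient f x i := by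
    have h1 : inner ℝ (gradient f x) (EuclideanSpace.single i (1 : ℝ))
        = fderiv ℝ f x (EuclideanSpace.single i 1) := by
      simp [gradient]
    rw [← h1, EuclideanSpace.inner_single_right]
    simp
  rw [h, Real.norm_eq_abs, sq_abs]

/-- `w` is `C²` in the bounded open set `Ω`, continuous up to the boundary, and vanishes there. -/
structure IsDirichlet (Ω : Set R2) (w : R2 → ℝ) : Prop where
  isOpen : IsOpen Ω
  isBounded : Bornology.IsBounded Ω
  contDiffOn : ContDiffOn ℝ 2 w Ω
  continuousOn : ContinuousOn w (closure Ω)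
  eq_zero : ∀ x ∈ frontier Ω, w x = 0

namespace IsDirichlet

variable {Ω : Set R2} {w : R2 → ℝ}

theorem isCompact_superlevel (hw : IsDirichlet Ω w) {ε : ℝ} (hε : 0 < ε) :
    IsCompact {x | x ∈ Ω ∧ ε ≤ w x} := by
  have h1 : {x | x ∈ Ω ∧ ε ≤ w x} = closure Ω ∩ w ⁻¹' Ici ε := by
    ext x
    refine ⟨fun h => ⟨subset_closure h.1, h.2⟩, fun h => ⟨?_, h.2⟩⟩
    by_contra hx
    have h3 : x ∈ frontier Ω := by
      rw [frontier, hw.isOpen.interior_eq]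
      exact ⟨h.1, hx⟩
    have h4 : ε ≤ w x := h.2
    rw [hw.eq_zero x h3] at h4
    exact absurd h4 (not_le.2 hε)
  rw [h1]
  have hc : IsCompact (closure Ω) := hw.isBounded.isCompact_closure
  exact hc.of_isClosed_subset (hw.continuousOn.preimage_isClosed_of_isClosed isClosed_closure
    isClosed_Ici) inter_subset_left

theorem contDiffAt (hw : IsDirichlet Ω w) {x : R2} (hx : x ∈ Ω) : ContDiffAt ℝ 2 w x :=
  hw.contDiffOn.contDiffAt (hw.isOpen.mem_nhds hx)

theorem continuousOn_gradient (hw : IsDirichlet Ω w) :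
    ContinuousOn (fun x => ‖gradient w x‖) Ω := by
  simp_rw [norm_gradient_eq]
  exact (hw.contDiffOn.continuousOn_fderiv_of_isOpen hw.isOpen (by norm_num)).norm

theorem continuousOn_self (hw : IsDirichlet Ω w) : ContinuousOn w Ω :=
  hw.contDiffOn.continuousOn

theorem differentiableAt_partial (hw : IsDirichlet Ω w) (e : R2) {x : R2} (hx : x ∈ Ω) :
    DifferentiableAt ℝ (fun y => fderiv ℝ w y e) x := by
  have h : ContDiffAt ℝ 1 (fderiv ℝ w) x := (hw.contDiffAt hx).fderiv_right (by norm_num)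
  exact (h.differentiableAt one_ne_zero).clm_apply (differentiableAt_const e)

theorem continuousOn_second_partial (hw : IsDirichlet Ω w) (e : R2) :
    ContinuousOn (fun x => fderiv ℝ (fun y => fderiv ℝ w y e) x e) Ω := by
  have h : ContDiffOn ℝ 1 (fun y => fderiv ℝ w y e) Ω :=
    (hw.contDiffOn.fderiv_of_isOpen hw.isOpen (by norm_num)).clm_apply contDiffOn_const
  exact (h.continuousOn_fderiv_of_isOpen hw.isOpen le_rfl).clm_apply continuousOn_const

theorem integrable_indicator (hw : IsDirichlet Ω w) {h : R2 → ℝ} {φ : ℝ → ℝ} {ε : ℝ} (hε : 0 < ε)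
    (hφ : Continuous φ) (hφ0 : ∀ τ ≤ ε, φ τ = 0) (hh : ContinuousOn h Ω) :
    IntegrableOn (fun x => φ (w x) * h x) Ω := by
  rw [← integrable_indicator_iff hw.isOpen.measurableSet]
  have hK := hw.isCompact_superlevel hε
  have sub : {x | x ∈ Ω ∧ ε ≤ w x} ⊆ Ω := fun x hx => hx.1
  rw [← integrableOn_iff_integrable_of_support_subset (s := {x | x ∈ Ω ∧ ε ≤ w x})]
  · refine ContinuousOn.integrableOn_compact hK (ContinuousOn.congr (f := fun x => φ (w x) * h x)
      ?_ fun x hx => indicator_of_mem (sub hx) _)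
    exact ((hφ.comp_continuousOn hw.continuousOn_self).mul hh).mono sub
  · intro x hx
    have hxΩ : x ∈ Ω := mem_of_indicator_ne_zero hx
    refine ⟨hxΩ, ?_⟩
    by_contra! hlt
    apply hx
    simp [hφ0 _ hlt.le]

/-- The truncation of `w` with derivative profile `η`, extended by zero. -/
def trunc (Ω : Set R2) (w : R2 → ℝ) (η : ℝ → ℝ) : R2 → ℝ :=
  Ω.indicator fun x => ∫ τ in (0 : ℝ)..w x, η τ

section Trunc

variable {η : ℝ → ℝ} {ε : ℝ}

theorem primitive_eq_zero (hε : 0 < ε) (h0 : ∀ τ ≤ ε, η τ = 0) {a : ℝ} (ha : a ≤ ε) :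
    ∫ τ in (0 : ℝ)..a, η τ = 0 := by
  rw [intervalIntegral.integral_congr (g := fun _ => 0)]
  · simp
  · intro τ hτ
    rw [uIcc, mem_Icc] at hτ
    exact h0 τ (hτ.2.trans (max_le hε.le ha))

theorem trunc_eq_zero (hε : 0 < ε) (h0 : ∀ τ ≤ ε, η τ = 0) {x : R2}
    (hx : x ∉ {x | x ∈ Ω ∧ ε ≤ w x}) : trunc Ω w η x = 0 := by
  by_cases hxΩ : x ∈ Ω
  · have : w x ≤ ε := by
      by_contra! h
      exact hx ⟨hxΩ, h.le⟩
    rw [trunc, indicator_of_mem hxΩ, primitive_eq_zero hε h0 this]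
  · rw [trunc, indicator_of_notMem hxΩ]

theorem trunc_eventuallyEq (hw : IsDirichlet Ω w) {x : R2} (hx : x ∈ Ω) :
    trunc Ω w η =ᶠ[𝓝 x] fun y => ∫ τ in (0 : ℝ)..w y, η τ := by
  filter_upwards [hw.isOpen.mem_nhds hx] with y hy
  exact indicator_of_mem hy _

theorem trunc_eventuallyEq_zero (hw : IsDirichlet Ω w) (hε : 0 < ε) (h0 : ∀ τ ≤ ε, η τ = 0)
    {x : R2} (hx : x ∉ Ω) : trunc Ω w η =ᶠ[𝓝 x] fun _ => 0 := by
  have hK := (hw.isCompact_superlevel hε).isClosed.isOpen_compl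
  filter_upwards [hK.mem_nhds fun h => hx h.1] with y hy
  exact trunc_eq_zero hε h0 hy

theorem hasDerivAt_primitive (hη : Continuous η) (a : ℝ) :
    HasDerivAt (fun a => ∫ τ in (0 : ℝ)..a, η τ) (η a) a :=
  intervalIntegral.integral_hasDerivAt_right (hη.intervalIntegrable _ _)
    (hη.stronglyMeasurableAtFilter _ _) hη.continuousAt

theorem contDiff_primitive (hη : Continuous η) :
    ContDiff ℝ 1 (fun a => ∫ τ in (0 : ℝ)..a, η τ) := by
  rw [contDiff_one_iff_deriv]
  refine ⟨fun a => (hasDerivAt_primitive hη a).differentiableAt, ?_⟩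
  have : deriv (fun a => ∫ τ in (0 : ℝ)..a, η τ) = η :=
    funext fun a => (hasDerivAt_primitive hη a).deriv
  rwa [this]

theorem contDiff_trunc (hw : IsDirichlet Ω w) (hη : Continuous η) (hε : 0 < ε)
    (h0 : ∀ τ ≤ ε, η τ = 0) : ContDiff ℝ 1 (trunc Ω w η) := by
  rw [contDiff_iff_contDiffAt]
  intro x
  by_cases hx : x ∈ Ω
  · refine ContDiffAt.congr_of_eventuallyEq ?_ (trunc_eventuallyEq hw hx)
    exact (contDiff_primitive hη).contDiffAt.comp x ((hw.contDiffAt hx).of_le (by norm_num))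
  · exact contDiffAt_const.congr_of_eventuallyEq (trunc_eventuallyEq_zero hw hε h0 hx)

theorem fderiv_trunc (hw : IsDirichlet Ω w) (hη : Continuous η) (hε : 0 < ε)
    (h0 : ∀ τ ≤ ε, η τ = 0) (x : R2) :
    fderiv ℝ (trunc Ω w η) x = Ω.indicator (fun x => η (w x) • fderiv ℝ w x) x := by
  by_cases hx : x ∈ Ω
  · rw [(trunc_eventuallyEq hw hx).fderiv_eq, indicator_of_mem hx]
    have hd := ((hw.contDiffAt hx).differentiableAt (by norm_num)).hasFDerivAt
    exact ((hasDerivAt_primitive hη (w x)).comp_hasFDerivAt x hd).fderiv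
  · rw [(trunc_eventuallyEq_zero hw hε h0 hx).fderiv_eq, indicator_of_notMem hx]
    simp

theorem hasCompactSupport_trunc (hw : IsDirichlet Ω w) (hε : 0 < ε) (h0 : ∀ τ ≤ ε, η τ = 0) :
    HasCompactSupport (trunc Ω w η) :=
  HasCompactSupport.intro (hw.isCompact_superlevel hε) fun _ hx => trunc_eq_zero hε h0 hx

theorem tsupport_trunc_subset (hw : IsDirichlet Ω w) (hε : 0 < ε) (h0 : ∀ τ ≤ ε, η τ = 0) :
    tsupport (trunc Ω w η) ⊆ Ω := by
  refine (closure_minimal (fun x hx => ?_) (hw.isCompact_superlevel hε).isClosed).trans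
    fun x hx => hx.1
  by_contra h
  exact hx (trunc_eq_zero hε h0 h)

theorem isoperimetric (hw : IsDirichlet Ω w) (hη : Continuous η) (hε : 0 < ε)
    (h0 : ∀ τ ≤ ε, η τ = 0) (hpos : ∀ τ, 0 ≤ η τ) {H : ℝ} (hH : 0 < H)
    (hle : ∀ a, ∫ τ in (0 : ℝ)..a, η τ ≤ H) :
    2 * √π * H * √(volume.real {x | x ∈ Ω ∧ H ≤ ∫ τ in (0 : ℝ)..w x, η τ})
      ≤ ∫ x in Ω, η (w x) * ‖gradient w x‖ := by
  have hnn : ∀ a, 0 ≤ ∫ τ in (0 : ℝ)..a, η τ := by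
    intro a
    rcases le_total 0 a with ha | ha
    · exact intervalIntegral.integral_nonneg ha fun τ _ => hpos τ
    · rw [primitive_eq_zero hε h0 (ha.trans hε.le)]
  have key := isoperimetric_of_contDiff (contDiff_trunc hw hη hε h0)
    (hasCompactSupport_trunc hw hε h0) hH (fun x => indicator_nonneg (fun x _ => hnn _) x)
    (fun x => by
      by_cases hx : x ∈ Ω
      · rw [trunc, indicator_of_mem hx]; exact hle _
      · rw [trunc, indicator_of_notMem hx]; exact hH.le)
  have e1 : {x | H ≤ trunc Ω w η x} = {x | x ∈ Ω ∧ H ≤ ∫ τ in (0 : ℝ)..w x, η τ} := by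
    ext x
    by_cases hx : x ∈ Ω
    · simp [trunc, hx]
    · simp [trunc, hx, hH]
  have e2 : ∫ x, ‖fderiv ℝ (trunc Ω w η) x‖ = ∫ x in Ω, η (w x) * ‖gradient w x‖ := by
    rw [← integral_indicator hw.isOpen.measurableSet]
    refine integral_congr_ae (ae_of_all _ fun x => ?_)
    simp only [fderiv_trunc hw hη hε h0]
    by_cases hx : x ∈ Ω
    · simp [hx, norm_smul, norm_gradient_eq, abs_of_nonneg (hpos _)]
    · simp [hx]
  rwa [e1, e2] at key

theorem green_partial (hw : IsDirichlet Ω w) (hη : Continuous η) (hε : 0 < ε)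
    (h0 : ∀ τ ≤ ε, η τ = 0) (e : R2) :
    ∫ x in Ω, (∫ τ in (0 : ℝ)..w x, η τ) * fderiv ℝ (fun y => fderiv ℝ w y e) x e
      = -∫ x in Ω, η (w x) * fderiv ℝ w x e ^ 2 := by
  have cψ : Continuous (fun a => ∫ τ in (0 : ℝ)..a, η τ) := (contDiff_primitive hη).continuous
  have hψ0 : ∀ a ≤ ε, ∫ τ in (0 : ℝ)..a, η τ = 0 := fun a => primitive_eq_zero hε h0
  have cG : ContinuousOn (fun y => fderiv ℝ w y e) Ω :=
    (hw.contDiffOn.continuousOn_fderiv_of_isOpen hw.isOpen (by norm_num)).clm_apply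
      continuousOn_const
  have m := hw.isOpen.measurableSet
  have t1 : ∀ x, trunc Ω w η x * fderiv ℝ (fun y => fderiv ℝ w y e) x e
      = Ω.indicator (fun x => (∫ τ in (0 : ℝ)..w x, η τ) *
        fderiv ℝ (fun y => fderiv ℝ w y e) x e) x := by
    intro x
    by_cases hx : x ∈ Ω <;> simp [trunc, hx]
  have t2 : ∀ x, fderiv ℝ (trunc Ω w η) x e * fderiv ℝ w x e
      = Ω.indicator (fun x => η (w x) * fderiv ℝ w x e ^ 2) x := by
    intro x
    rw [fderiv_trunc hw hη hε h0]
    by_cases hx : x ∈ Ω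
    · simp [hx]; ring
    · simp [hx]
  have t3 : ∀ x, trunc Ω w η x * fderiv ℝ w x e
      = Ω.indicator (fun x => (∫ τ in (0 : ℝ)..w x, η τ) * fderiv ℝ w x e) x := by
    intro x
    by_cases hx : x ∈ Ω <;> simp [trunc, hx]
  have key := integral_bilinear_hasFDerivAt_right_eq_neg_left_of_integrable
    (μ := volume) (f := trunc Ω w η) (f' := fderiv ℝ (trunc Ω w η))
    (g := fun y => fderiv ℝ w y e) (g' := fderiv ℝ fun y => fderiv ℝ w y e) (v := e)
    (B := ContinuousLinearMap.mul ℝ ℝ) ?_ ?_ ?_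
    (fun x _ => ((contDiff_trunc hw hη hε h0).differentiable one_ne_zero x).hasFDerivAt)
    (fun x hx => (hw.differentiableAt_partial e
      (tsupport_trunc_subset hw hε h0 hx)).hasFDerivAt)
  · simp only [ContinuousLinearMap.mul_apply', t1, t2] at key
    rwa [integral_indicator m, integral_indicator m] at key
  · simp only [ContinuousLinearMap.mul_apply', t2]
    exact (integrable_indicator_iff m).2 (hw.integrable_indicator hε hη h0 (cG.pow 2))
  · simp only [ContinuousLinearMap.mul_apply', t1]
    exact (integrable_indicator_iff m).2
      (hw.integrable_indicator hε cψ hψ0 (hw.continuousOn_second_partial e))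
  · simp only [ContinuousLinearMap.mul_apply', t3]
    exact (integrable_indicator_iff m).2 (hw.integrable_indicator hε cψ hψ0 cG)

/-- Green's identity tested against a function of `w`. -/
theorem green (hw : IsDirichlet Ω w) (hη : Continuous η) (hε : 0 < ε)
    (h0 : ∀ τ ≤ ε, η τ = 0) :
    ∫ x in Ω, η (w x) * ‖gradient w x‖ ^ 2
      = ∫ x in Ω, (∫ τ in (0 : ℝ)..w x, η τ) * -lap w x := by
  have cψ : Continuous (fun a => ∫ τ in (0 : ℝ)..a, η τ) := (contDiff_primitive hη).continuous
  have hψ0 : ∀ a ≤ ε, ∫ τ in (0 : ℝ)..a, η τ = 0 := fun a => primitive_eq_zero hε h0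
  have cG : ∀ e : R2, ContinuousOn (fun y => fderiv ℝ w y e) Ω := fun e =>
    (hw.contDiffOn.continuousOn_fderiv_of_isOpen hw.isOpen (by norm_num)).clm_apply
      continuousOn_const
  simp_rw [norm_gradient_sq_eq, lap, Finset.mul_sum, ← Finset.sum_neg_distrib, Finset.mul_sum]
  rw [integral_finsetSum _ fun i _ => hw.integrable_indicator
      (h := fun x => fderiv ℝ w x (EuclideanSpace.single i 1) ^ 2) hε hη h0 ((cG _).pow 2),
    integral_finsetSum _ fun i _ => hw.integrable_indicator
      (h := fun x => -fderiv ℝ (fun y => fderiv ℝ w y (EuclideanSpace.single i 1)) x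
        (EuclideanSpace.single i 1)) hε cψ hψ0 (hw.continuousOn_second_partial _).neg]
  refine Finset.sum_congr rfl fun i _ => ?_
  simp_rw [mul_neg]
  rw [integral_neg, green_partial hw hη hε h0, neg_neg]

end Trunc

end IsDirichlet

theorem sub_le_integral_of_eq_one {η : ℝ → ℝ} (hη : Continuous η) (h0 : ∀ τ, 0 ≤ η τ)
    {a b c d : ℝ} (hac : a ≤ c) (hcd : c ≤ d) (hdb : d ≤ b) (h1 : ∀ τ ∈ Icc c d, η τ = 1) :
    d - c ≤ ∫ τ in a..b, η τ := by
  have e : ∫ τ in c..d, η τ = d - c := by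
    rw [intervalIntegral.integral_congr (g := fun _ => 1)]
    · simp
    · intro τ hτ
      exact h1 τ (by rwa [uIcc_of_le hcd] at hτ)
  rw [← e]
  exact intervalIntegral.integral_mono_interval hac hcd hdb (ae_of_all _ h0)
    (hη.intervalIntegrable _ _)

theorem exists_trapezoid {s t ε : ℝ} (hs : 0 ≤ s) (hε : 0 < ε) (h : 4 * ε < t - s) :
    ∃ η : ℝ → ℝ, Continuous η ∧ (∀ τ, 0 ≤ η τ) ∧ (∀ τ, η τ ≤ 1) ∧ (∀ τ ≤ s + ε, η τ = 0) ∧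
      (∀ τ, t ≤ τ → η τ = 0) ∧ t - s - 4 * ε ≤ ∫ τ in (0 : ℝ)..t, η τ := by
  set η : ℝ → ℝ := fun τ => max 0 (min 1 (min (τ - s - ε) (t - ε - τ) / ε)) with hηd
  have hc : Continuous η := by fun_prop
  have h0 : ∀ τ, 0 ≤ η τ := fun τ => le_max_left _ _
  refine ⟨η, hc, h0, fun τ => max_le zero_le_one (min_le_left _ _), ?_, ?_, ?_⟩
  · intro τ hτ
    refine max_eq_left ((min_le_right _ _).trans (div_nonpos_of_nonpos_of_nonneg ?_ hε.le))
    exact (min_le_left _ _).trans (by linarith)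
  · intro τ hτ
    refine max_eq_left ((min_le_right _ _).trans (div_nonpos_of_nonpos_of_nonneg ?_ hε.le))
    exact (min_le_right _ _).trans (by linarith)
  · have := sub_le_integral_of_eq_one hc h0 (a := 0) (b := t) (c := s + 2 * ε) (d := t - 2 * ε)
      (by linarith) (by linarith) (by linarith) (fun τ hτ => by
        have : 1 ≤ min (τ - s - ε) (t - ε - τ) / ε := by
          rw [le_div_iff₀ hε]
          exact le_min (by linarith [hτ.1]) (by linarith [hτ.2])
        simp only [hηd]
        rw [min_eq_left this, max_eq_right zero_le_one])
    linarith

theorem sq_integral_mul_le {α : Type*} [MeasurableSpace α] {μ : Measure α} {f g : α → ℝ}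
    (hf : ∀ x, 0 ≤ f x) (h1 : Integrable (fun x => f x * g x) μ)
    (h2 : Integrable (fun x => f x * g x ^ 2) μ) (h3 : Integrable f μ) :
    (∫ x, f x * g x ∂μ) ^ 2 ≤ (∫ x, f x * g x ^ 2 ∂μ) * ∫ x, f x ∂μ := by
  have key : ∀ l : ℝ, 0 ≤ (∫ x, f x * g x ^ 2 ∂μ) * (l * l) + (-2 * ∫ x, f x * g x ∂μ) * l
      + ∫ x, f x ∂μ := by
    intro l
    have e : (∫ x, f x * g x ^ 2 ∂μ) * (l * l) + (-2 * ∫ x, f x * g x ∂μ) * l + ∫ x, f x ∂μ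
        = ∫ x, ((l * l) * (f x * g x ^ 2) + (-2 * l) * (f x * g x)) + f x ∂μ := by
      have h21 : Integrable (fun x => (l * l) * (f x * g x ^ 2) + (-2 * l) * (f x * g x)) μ :=
        (h2.const_mul _).add (h1.const_mul _)
      rw [integral_add h21 h3, integral_add (h2.const_mul _) (h1.const_mul _), integral_const_mul, integral_const_mul]
      ring
    rw [e]
    refine integral_nonneg fun x => ?_
    have : (l * l) * (f x * g x ^ 2) + (-2 * l) * (f x * g x) + f x
        = f x * (l * g x - 1) ^ 2 := by ring
    simp only [Pi.zero_apply]
    rw [this]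
    exact mul_nonneg (hf x) (sq_nonneg _)
  have := discrim_le_zero key
  rw [discrim] at this
  nlinarith

/-- The measure of the superlevel set of `w` in `Ω`. -/
def distrib (Ω : Set R2) (w : R2 → ℝ) (t : ℝ) : ℝ := volume.real {x | x ∈ Ω ∧ t ≤ w x}

/-- The integral of `w ^ p` over the superlevel set of `w` in `Ω`. -/
def massAbove (Ω : Set R2) (w : R2 → ℝ) (p t : ℝ) : ℝ := ∫ x in {x | x ∈ Ω ∧ t ≤ w x}, w x ^ p

namespace IsDirichlet

variable {Ω : Set R2} {w : R2 → ℝ} {p : ℝ}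

theorem measurableSet_superlevel (hw : IsDirichlet Ω w) (t : ℝ) :
    MeasurableSet {x | x ∈ Ω ∧ t ≤ w x} := by
  have h : {x | x ∈ Ω ∧ t ≤ w x} = Ω \ (Ω ∩ w ⁻¹' Iio t) := by
    ext x
    simp
  rw [h]
  exact hw.isOpen.measurableSet.diff
    (hw.continuousOn_self.isOpen_inter_preimage hw.isOpen isOpen_Iio).measurableSet

theorem volume_ne_top (hw : IsDirichlet Ω w) : volume Ω ≠ ⊤ := hw.isBounded.measure_lt_top.ne

theorem volume_superlevel_ne_top (hw : IsDirichlet Ω w) (t : ℝ) :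
    volume {x | x ∈ Ω ∧ t ≤ w x} ≠ ⊤ :=
  ((measure_mono fun _ hx => hx.1).trans_lt hw.volume_ne_top.lt_top).ne

theorem distrib_nonneg (t : ℝ) : 0 ≤ distrib Ω w t := measureReal_nonneg

theorem distrib_antitone (hw : IsDirichlet Ω w) : Antitone (distrib Ω w) := fun s _ hst =>
  measureReal_mono (fun _ hx => ⟨hx.1, hst.trans hx.2⟩) (hw.volume_superlevel_ne_top s)

theorem measurableSet_layer (hw : IsDirichlet Ω w) (s t : ℝ) :
    MeasurableSet {x | x ∈ Ω ∧ s ≤ w x ∧ w x < t} := by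
  have : {x | x ∈ Ω ∧ s ≤ w x ∧ w x < t}
      = {x | x ∈ Ω ∧ s ≤ w x} \ {x | x ∈ Ω ∧ t ≤ w x} := by
    ext x
    simp
    tauto
  rw [this]
  exact (hw.measurableSet_superlevel s).diff (hw.measurableSet_superlevel t)

theorem distrib_sub (hw : IsDirichlet Ω w) {s t : ℝ} (hst : s ≤ t) :
    distrib Ω w s - distrib Ω w t = volume.real {x | x ∈ Ω ∧ s ≤ w x ∧ w x < t} := by
  have : {x | x ∈ Ω ∧ s ≤ w x ∧ w x < t}
      = {x | x ∈ Ω ∧ s ≤ w x} \ {x | x ∈ Ω ∧ t ≤ w x} := by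
    ext x
    simp
    tauto
  have hsub : {x | x ∈ Ω ∧ t ≤ w x} ⊆ {x | x ∈ Ω ∧ s ≤ w x} :=
    fun x hx => ⟨hx.1, hst.trans hx.2⟩
  rw [this, measureReal_sdiff hsub (hw.measurableSet_superlevel t)
    (hw.volume_superlevel_ne_top s)]
  rfl

theorem capacity_core (hw : IsDirichlet Ω w) {s t ε : ℝ} (hs : 0 ≤ s) (hst : s < t) (hε : 0 < ε)
    {η : ℝ → ℝ} (hη : Continuous η) (h0 : ∀ τ, 0 ≤ η τ) (h1 : ∀ τ, η τ ≤ 1)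
    (hl : ∀ τ ≤ s + ε, η τ = 0) (hr : ∀ τ, t ≤ τ → η τ = 0) (hH : 0 < ∫ τ in (0 : ℝ)..t, η τ) :
    (∀ a, ∫ τ in (0 : ℝ)..a, η τ ≤ ∫ τ in (0 : ℝ)..t, η τ) ∧
    4 * π * distrib Ω w t * (∫ τ in (0 : ℝ)..t, η τ) ^ 2
      ≤ (∫ x in Ω, η (w x) * ‖gradient w x‖ ^ 2) * (distrib Ω w s - distrib Ω w t) := by
  set H := ∫ τ in (0 : ℝ)..t, η τ with hHd
  have hsε : 0 < s + ε := by linarith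
  have hadd : ∀ a, (∫ τ in (0 : ℝ)..a, η τ) + ∫ τ in a..t, η τ = H := fun a =>
    intervalIntegral.integral_add_adjacent_intervals (hη.intervalIntegrable _ _)
      (hη.intervalIntegrable _ _)
  have after : ∀ a, t ≤ a → ∫ τ in (0 : ℝ)..a, η τ = H := by
    intro a ha
    have : ∫ τ in a..t, η τ = 0 := by
      rw [intervalIntegral.integral_congr (g := fun _ => 0)]
      · simp
      · intro τ hτ
        exact hr τ (by rw [uIcc_of_ge ha] at hτ; exact hτ.1)
    have := hadd a
    linarith
  have le : ∀ a, ∫ τ in (0 : ℝ)..a, η τ ≤ H := by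
    intro a
    rcases le_total a t with ha | ha
    · have := hadd a
      have := intervalIntegral.integral_nonneg (μ := volume) ha fun τ _ => h0 τ
      linarith
    · exact (after a ha).le
  refine ⟨le, ?_⟩
  have iso := hw.isoperimetric hη hsε hl h0 hH le
  have i1 : IntegrableOn (fun x => η (w x) * ‖gradient w x‖) Ω :=
    hw.integrable_indicator hsε hη hl hw.continuousOn_gradient
  have i2 : IntegrableOn (fun x => η (w x) * ‖gradient w x‖ ^ 2) Ω :=
    hw.integrable_indicator hsε hη hl (hw.continuousOn_gradient.pow 2)
  have i3 : IntegrableOn (fun x => η (w x)) Ω := by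
    simpa using hw.integrable_indicator (h := fun _ => 1) hsε hη hl continuousOn_const
  have cs := sq_integral_mul_le (fun x => h0 (w x)) i1 i2 i3
  have hmu : distrib Ω w t
      ≤ volume.real {x | x ∈ Ω ∧ H ≤ ∫ τ in (0 : ℝ)..w x, η τ} := by
    refine measureReal_mono (fun x hx => ⟨hx.1, (after _ hx.2).ge⟩) ?_
    exact ((measure_mono fun x hx => hx.1).trans_lt hw.volume_ne_top.lt_top).ne
  have hlay : ∫ x in Ω, η (w x) ≤ distrib Ω w s - distrib Ω w t := by
    have ml := hw.measurableSet_layer s t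
    have fl : volume {x | x ∈ Ω ∧ s ≤ w x ∧ w x < t} ≠ ⊤ :=
      ((measure_mono fun x hx => hx.1).trans_lt hw.volume_ne_top.lt_top).ne
    rw [hw.distrib_sub hst.le, ← integral_indicator_one ml, ← integral_indicator
      hw.isOpen.measurableSet]
    refine integral_mono ((integrable_indicator_iff hw.isOpen.measurableSet).2 i3)
      ((integrable_indicator_iff ml).2 (integrableOn_const fl)) fun x => ?_
    by_cases hx : x ∈ Ω
    · by_cases hx2 : s ≤ w x ∧ w x < t
      · have : x ∈ {x | x ∈ Ω ∧ s ≤ w x ∧ w x < t} := ⟨hx, hx2⟩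
        simp [hx, hx2, h1]
      · have h4 : η (w x) = 0 := by
          rw [not_and_or, not_le, not_lt] at hx2
          rcases hx2 with h | h
          · exact hl _ (by linarith)
          · exact hr _ h
        simp [hx, h4]
        exact indicator_nonneg (fun _ _ => zero_le_one) _
    · simp [hx]
  have hD : 0 ≤ ∫ x in Ω, η (w x) * ‖gradient w x‖ ^ 2 :=
    integral_nonneg fun x => mul_nonneg (h0 _) (sq_nonneg _)
  calc 4 * π * distrib Ω w t * H ^ 2 = (2 * √π * H * √(distrib Ω w t)) ^ 2 := by
        rw [mul_pow, mul_pow, mul_pow, Real.sq_sqrt pi_pos.le, Real.sq_sqrt (distrib_nonneg t)]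
        ring
    _ ≤ (∫ x in Ω, η (w x) * ‖gradient w x‖) ^ 2 := by
        refine pow_le_pow_left₀ (by positivity) (le_trans ?_ iso) 2
        gcongr
    _ ≤ _ := cs.trans (mul_le_mul_of_nonneg_left hlay hD)

/-- The capacity inequality between two levels of `w`. -/
theorem capacity_le (hw : IsDirichlet Ω w)
    (hint : IntegrableOn (fun x => ‖gradient w x‖ ^ 2) Ω) {s t : ℝ} (hs : 0 ≤ s) (hst : s < t) :
    4 * π * distrib Ω w t * (t - s) ^ 2
      ≤ (∫ x in {x | x ∈ Ω ∧ s < w x ∧ w x < t}, ‖gradient w x‖ ^ 2)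
        * (distrib Ω w s - distrib Ω w t) := by
  have mO : MeasurableSet {x | x ∈ Ω ∧ s < w x ∧ w x < t} :=
    (hw.continuousOn_self.isOpen_inter_preimage hw.isOpen isOpen_Ioo).measurableSet
  set D := ∫ x in {x | x ∈ Ω ∧ s < w x ∧ w x < t}, ‖gradient w x‖ ^ 2
  have hsub : 0 ≤ distrib Ω w s - distrib Ω w t := sub_nonneg.2 (hw.distrib_antitone hst.le)
  have key : ∀ᶠ ε in 𝓝[>] (0 : ℝ), 4 * π * distrib Ω w t * (t - s - 4 * ε) ^ 2
      ≤ D * (distrib Ω w s - distrib Ω w t) := by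
    filter_upwards [Ioo_mem_nhdsGT (show (0 : ℝ) < (t - s) / 4 by linarith)] with ε hε
    have h4 : 4 * ε < t - s := by linarith [hε.2]
    obtain ⟨η, hη, h0, h1, hl, hr, hH⟩ := exists_trapezoid hs hε.1 h4
    have hc := (hw.capacity_core hs hst hε.1 hη h0 h1 hl hr (by linarith)).2
    have hd0 : 0 ≤ distrib Ω w t := distrib_nonneg t
    refine le_trans ?_ (hc.trans (mul_le_mul_of_nonneg_right ?_ hsub))
    · gcongr
    · simp only [D]
      rw [← integral_indicator hw.isOpen.measurableSet, ← integral_indicator mO]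
      refine integral_mono ((integrable_indicator_iff hw.isOpen.measurableSet).2
        (hw.integrable_indicator (by linarith [hε.1]) hη hl (hw.continuousOn_gradient.pow 2)))
        ((integrable_indicator_iff mO).2 (hint.mono_set fun x hx => hx.1)) fun x => ?_
      by_cases hx : x ∈ Ω
      · by_cases hx2 : s < w x ∧ w x < t
        · simp only [indicator_of_mem hx]
          rw [indicator_of_mem (show x ∈ {x | x ∈ Ω ∧ s < w x ∧ w x < t} from ⟨hx, hx2⟩)]
          exact mul_le_of_le_one_left (sq_nonneg _) (h1 _)
        · have h4 : η (w x) = 0 := by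
            rw [not_and_or, not_lt, not_lt] at hx2
            rcases hx2 with h | h
            · exact hl _ (by linarith [hε.1])
            · exact hr _ h
          simp [hx, h4]
          exact indicator_nonneg (fun _ _ => sq_nonneg _) _
      · simp [hx]
  refine le_of_tendsto (x := 𝓝[>] (0 : ℝ)) ?_ key
  refine tendsto_nhdsWithin_of_tendsto_nhds ?_
  have : Continuous fun ε : ℝ => 4 * π * distrib Ω w t * (t - s - 4 * ε) ^ 2 := by fun_prop
  simpa using this.tendsto 0

theorem integrableOn_of_bound (hw : IsDirichlet Ω w) {M : ℝ} (hM : ∀ x ∈ Ω, w x ≤ M)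
    {φ : ℝ → ℝ} (hφ : Continuous φ) {s : ℝ} :
    IntegrableOn (fun x => φ (w x)) {x | x ∈ Ω ∧ s ≤ w x} := by
  obtain ⟨C, hC⟩ := (isCompact_Icc (a := s) (b := M)).exists_bound_of_continuousOn hφ.continuousOn
  refine IntegrableOn.of_bound (hw.volume_superlevel_ne_top s).lt_top ?_ C ?_
  · exact ((hφ.comp_continuousOn hw.continuousOn_self).mono fun x hx => hx.1).aestronglyMeasurable
      (hw.measurableSet_superlevel s)
  · filter_upwards [ae_restrict_mem (hw.measurableSet_superlevel s)] with x hx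
    exact hC _ ⟨hx.2, hM x hx.1⟩

/-- The isoperimetric differential inequality in finite-difference form. -/
theorem mass_le (hw : IsDirichlet Ω w) (hp : 0 < p)
    (heq : ∀ x ∈ Ω, -lap w x = |w x| ^ (p - 1) * w x) {M : ℝ} (hM : ∀ x ∈ Ω, w x ≤ M)
    {s t : ℝ} (hs : 0 ≤ s) (hst : s < t) :
    4 * π * distrib Ω w t * (t - s)
      ≤ massAbove Ω w p s * (distrib Ω w s - distrib Ω w t) := by
  have hsub : 0 ≤ distrib Ω w s - distrib Ω w t := sub_nonneg.2 (hw.distrib_antitone hst.le)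
  have mS := hw.measurableSet_superlevel s
  have iF : IntegrableOn (fun x => w x ^ p) {x | x ∈ Ω ∧ s ≤ w x} :=
    hw.integrableOn_of_bound hM (φ := fun a => a ^ p) (Real.continuous_rpow_const hp.le)
  have key : ∀ᶠ ε in 𝓝[>] (0 : ℝ), 4 * π * distrib Ω w t * (t - s - 4 * ε)
      ≤ massAbove Ω w p s * (distrib Ω w s - distrib Ω w t) := by
    filter_upwards [Ioo_mem_nhdsGT (show (0 : ℝ) < (t - s) / 4 by linarith)] with ε hε
    have h4 : 4 * ε < t - s := by linarith [hε.2]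
    obtain ⟨η, hη, h0, h1, hl, hr, hH⟩ := exists_trapezoid hs hε.1 h4
    have hsε : 0 < s + ε := by linarith [hε.1]
    obtain ⟨hle, hc⟩ := hw.capacity_core hs hst hε.1 hη h0 h1 hl hr (by linarith)
    set H := ∫ τ in (0 : ℝ)..t, η τ
    have hH0 : 0 < H := by linarith
    have hd0 : 0 ≤ distrib Ω w t := distrib_nonneg t
    have hgreen : ∫ x in Ω, η (w x) * ‖gradient w x‖ ^ 2 ≤ H * massAbove Ω w p s := by
      rw [hw.green hη hsε hl, massAbove, ← integral_const_mul,
        ← integral_indicator hw.isOpen.measurableSet, ← integral_indicator mS]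
      refine integral_mono_of_nonneg (ae_of_all _ fun x => ?_)
        ((integrable_indicator_iff mS).2 (iF.const_mul _)) (ae_of_all _ fun x => ?_)
      all_goals
        by_cases hx : x ∈ Ω
        swap
        · simp [hx]
        rcases le_total (w x) (s + ε) with h | h
        · simp only [Pi.zero_apply, indicator_of_mem hx, primitive_eq_zero hsε hl h, zero_mul]
          first
          | exact le_rfl
          | exact indicator_nonneg (fun y hy => mul_nonneg hH0.le
            (Real.rpow_nonneg (hs.trans hy.2) _)) _
        have hwx : 0 < w x := hsε.trans_le h
        have hwp : |w x| ^ (p - 1) * w x = w x ^ p := by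
          rw [abs_of_pos hwx, Real.rpow_sub_one hwx.ne']
          field_simp
        simp only [Pi.zero_apply, indicator_of_mem hx, heq x hx, hwp]
      · exact mul_nonneg (intervalIntegral.integral_nonneg hwx.le fun τ _ => h0 τ)
          (Real.rpow_nonneg hwx.le _)
      · rw [indicator_of_mem (show x ∈ {x | x ∈ Ω ∧ s ≤ w x} from ⟨hx, by linarith [hε.1]⟩)]
        exact mul_le_mul_of_nonneg_right (hle _) (Real.rpow_nonneg hwx.le _)
    have h5 : H * (4 * π * distrib Ω w t * H)
        ≤ H * (massAbove Ω w p s * (distrib Ω w s - distrib Ω w t)) := by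
      have := hc.trans (mul_le_mul_of_nonneg_right hgreen hsub)
      linarith
    refine le_trans ?_ (le_of_mul_le_mul_left h5 hH0)
    gcongr
  refine le_of_tendsto (x := 𝓝[>] (0 : ℝ)) ?_ key
  refine tendsto_nhdsWithin_of_tendsto_nhds ?_
  have : Continuous fun ε : ℝ => 4 * π * distrib Ω w t * (t - s - 4 * ε) := by fun_prop
  simpa using this.tendsto 0

end IsDirichlet

/-- A piecewise linear cutoff vanishing below `ε` and equal to `1` above `2 * ε`. -/
def cutoff (ε τ : ℝ) : ℝ := max 0 (min 1 ((τ - ε) / ε))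

theorem continuous_cutoff (ε : ℝ) : Continuous (cutoff ε) := by unfold cutoff; fun_prop

theorem cutoff_nonneg (ε τ : ℝ) : 0 ≤ cutoff ε τ := le_max_left _ _

theorem cutoff_le_one (ε τ : ℝ) : cutoff ε τ ≤ 1 := max_le zero_le_one (min_le_left _ _)

theorem cutoff_eq_zero {ε τ : ℝ} (hε : 0 < ε) (h : τ ≤ ε) : cutoff ε τ = 0 :=
  max_eq_left ((min_le_right _ _).trans
    (div_nonpos_of_nonpos_of_nonneg (by linarith) hε.le))

theorem cutoff_eq_one {ε τ : ℝ} (hε : 0 < ε) (h : 2 * ε ≤ τ) : cutoff ε τ = 1 := by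
  have : 1 ≤ (τ - ε) / ε := by
    rw [le_div_iff₀ hε]
    linarith
  rw [cutoff, min_eq_left this, max_eq_right zero_le_one]

theorem integral_cutoff_le {ε a : ℝ} (ha : 0 ≤ a) : ∫ τ in (0 : ℝ)..a, cutoff ε τ ≤ a := by
  have := intervalIntegral.integral_mono_on (μ := volume) ha
    ((continuous_cutoff ε).intervalIntegrable _ _)
    (intervalIntegrable_const (c := (1 : ℝ))) fun τ _ => cutoff_le_one ε τ
  simpa using this

theorem integral_cutoff_nonneg {ε a : ℝ} (ha : 0 ≤ a) : 0 ≤ ∫ τ in (0 : ℝ)..a, cutoff ε τ :=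
  intervalIntegral.integral_nonneg ha fun τ _ => cutoff_nonneg ε τ

theorem le_integral_cutoff {ε a : ℝ} (hε : 0 < ε) (h : 2 * ε ≤ a) :
    a - 2 * ε ≤ ∫ τ in (0 : ℝ)..a, cutoff ε τ :=
  sub_le_integral_of_eq_one (continuous_cutoff ε) (cutoff_nonneg ε) (by linarith) h le_rfl
    fun _ hτ => cutoff_eq_one hε hτ.1

theorem eventually_lt_of_pos {ε : ℕ → ℝ} (h : Tendsto ε atTop (𝓝 0)) {a : ℝ} (ha : 0 < a) :
    ∀ᶠ n in atTop, 2 * ε n ≤ a := by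
  filter_upwards [h.eventually (gt_mem_nhds (half_pos ha))] with n hn
  linarith

theorem tendsto_cutoff {ε : ℕ → ℝ} (hε : ∀ n, 0 < ε n) (h : Tendsto ε atTop (𝓝 0)) {a : ℝ}
    (ha : 0 < a) : Tendsto (fun n => cutoff (ε n) a) atTop (𝓝 1) := by
  refine tendsto_const_nhds.congr' ?_
  filter_upwards [eventually_lt_of_pos h ha] with n hn
  exact (cutoff_eq_one (hε n) hn).symm

theorem tendsto_integral_cutoff {ε : ℕ → ℝ} (hε : ∀ n, 0 < ε n) (h : Tendsto ε atTop (𝓝 0))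
    {a : ℝ} (ha : 0 < a) :
    Tendsto (fun n => ∫ τ in (0 : ℝ)..a, cutoff (ε n) τ) atTop (𝓝 a) := by
  refine tendsto_of_tendsto_of_tendsto_of_le_of_le' (g := fun n => a - 2 * ε n) ?_
    tendsto_const_nhds ?_ (Eventually.of_forall fun n => integral_cutoff_le ha.le)
  · simpa using (h.const_mul 2).const_sub a
  · filter_upwards [eventually_lt_of_pos h ha] with n hn
    exact le_integral_cutoff (hε n) hn

namespace IsDirichlet

variable {Ω : Set R2} {w : R2 → ℝ} {p M : ℝ}

/-- The energy identity on the positive part. -/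
theorem energy_identity (hw : IsDirichlet Ω w)
    (hint : IntegrableOn (fun x => ‖gradient w x‖ ^ 2) Ω) (hp : 0 < p)
    (heq : ∀ x ∈ Ω, -lap w x = |w x| ^ (p - 1) * w x) (hM : ∀ x ∈ Ω, w x ≤ M) :
    ∫ x in {x | x ∈ Ω ∧ 0 < w x}, ‖gradient w x‖ ^ 2 = massAbove Ω w (p + 1) 0 := by
  have m := hw.isOpen.measurableSet
  have m0 : MeasurableSet {x | x ∈ Ω ∧ 0 < w x} :=
    (hw.continuousOn_self.isOpen_inter_preimage hw.isOpen isOpen_Ioi).measurableSet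
  have mS := hw.measurableSet_superlevel 0
  set ε : ℕ → ℝ := fun n => 1 / ((n : ℝ) + 1)
  have hε : ∀ n, 0 < ε n := fun n => by positivity
  have hlim : Tendsto ε atTop (𝓝 0) := tendsto_one_div_add_atTop_nhds_zero_nat
  have heq' : ∀ x ∈ Ω, 0 < w x → -lap w x = w x ^ p := fun x hx hwx => by
    rw [heq x hx, abs_of_pos hwx, Real.rpow_sub_one hwx.ne']
    field_simp
  have hneg : ∀ n x, w x ≤ 0 → cutoff (ε n) (w x) = 0 := fun n x hx =>
    cutoff_eq_zero (hε n) (hx.trans (hε n).le)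
  have hneg' : ∀ n x, w x ≤ 0 → ∫ τ in (0 : ℝ)..w x, cutoff (ε n) τ = 0 := fun n x hx =>
    primitive_eq_zero (hε n) (fun τ hτ => cutoff_eq_zero (hε n) hτ) (hx.trans (hε n).le)
  have l1 : Tendsto (fun n => ∫ x in Ω, cutoff (ε n) (w x) * ‖gradient w x‖ ^ 2) atTop
      (𝓝 (∫ x in {x | x ∈ Ω ∧ 0 < w x}, ‖gradient w x‖ ^ 2)) := by
    have e : ∫ x in {x | x ∈ Ω ∧ 0 < w x}, ‖gradient w x‖ ^ 2
        = ∫ x in Ω, {x | x ∈ Ω ∧ 0 < w x}.indicator (fun x => ‖gradient w x‖ ^ 2) x := by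
      rw [setIntegral_indicator m0]
      congr 2
      ext x
      simp
    rw [e]
    refine tendsto_integral_of_dominated_convergence (fun x => ‖gradient w x‖ ^ 2)
      (fun n => ?_) hint (fun n => ae_of_all _ fun x => ?_) ?_
    · exact (((continuous_cutoff _).comp_continuousOn hw.continuousOn_self).mul
        (hw.continuousOn_gradient.pow 2)).aestronglyMeasurable m
    · rw [Real.norm_of_nonneg (mul_nonneg (cutoff_nonneg _ _) (sq_nonneg _))]
      exact mul_le_of_le_one_left (sq_nonneg _) (cutoff_le_one _ _)
    · filter_upwards [ae_restrict_mem m] with x hx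
      by_cases hwx : 0 < w x
      · rw [indicator_of_mem (show x ∈ {x | x ∈ Ω ∧ 0 < w x} from ⟨hx, hwx⟩)]
        simpa using (tendsto_cutoff hε hlim hwx).mul_const (‖gradient w x‖ ^ 2)
      · rw [indicator_of_notMem (fun h => hwx h.2)]
        simp [hneg _ x (not_lt.1 hwx)]
  have l2 : Tendsto (fun n => ∫ x in Ω, (∫ τ in (0 : ℝ)..w x, cutoff (ε n) τ) * -lap w x) atTop
      (𝓝 (massAbove Ω w (p + 1) 0)) := by
    have e : massAbove Ω w (p + 1) 0
        = ∫ x in Ω, {x | x ∈ Ω ∧ 0 ≤ w x}.indicator (fun x => w x ^ (p + 1)) x := by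
      rw [setIntegral_indicator mS, massAbove]
      congr 2
      ext x
      simp
    have hi : IntegrableOn ({x | x ∈ Ω ∧ 0 ≤ w x}.indicator (fun x => w x ^ (p + 1))) Ω :=
      ((integrable_indicator_iff mS).2 (hw.integrableOn_of_bound hM
        (φ := fun a => a ^ (p + 1)) (Real.continuous_rpow_const (by linarith)))).integrableOn
    have hexp : ∀ x, 0 < w x → w x * w x ^ p = w x ^ (p + 1) := fun x hx => by
      rw [Real.rpow_add_one hx.ne', mul_comm]
    rw [e]
    refine tendsto_integral_of_dominated_convergence _ (fun n => ?_) hi (fun n => ?_) ?_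
    · refine (ContinuousOn.mul (f := fun x => ∫ τ in (0 : ℝ)..w x, cutoff (ε n) τ) ?_
        ?_).aestronglyMeasurable m
      · exact (contDiff_primitive (continuous_cutoff _)).continuous.comp_continuousOn
          hw.continuousOn_self
      · refine ContinuousOn.neg ?_
        exact continuousOn_finsetSum _ fun i _ => hw.continuousOn_second_partial _
    · filter_upwards [ae_restrict_mem m] with x hx
      rcases le_or_gt (w x) 0 with hwx | hwx
      · rw [hneg' n x hwx, zero_mul, norm_zero]
        exact indicator_nonneg (fun y hy => Real.rpow_nonneg hy.2 _) _
      · rw [indicator_of_mem (show x ∈ {x | x ∈ Ω ∧ 0 ≤ w x} from ⟨hx, hwx.le⟩), heq' x hx hwx,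
          Real.norm_of_nonneg (mul_nonneg (integral_cutoff_nonneg hwx.le)
            (Real.rpow_nonneg hwx.le _)), ← hexp x hwx]
        exact mul_le_mul_of_nonneg_right (integral_cutoff_le hwx.le) (Real.rpow_nonneg hwx.le _)
    · filter_upwards [ae_restrict_mem m] with x hx
      rcases le_or_gt (w x) 0 with hwx | hwx
      · have : {x | x ∈ Ω ∧ 0 ≤ w x}.indicator (fun x => w x ^ (p + 1)) x = 0 := by
          by_cases h : x ∈ {x | x ∈ Ω ∧ 0 ≤ w x}
          · rw [indicator_of_mem h, le_antisymm hwx h.2, Real.zero_rpow (by linarith)]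
          · exact indicator_of_notMem h _
        simp [hneg' _ x hwx, this]
      · rw [indicator_of_mem (show x ∈ {x | x ∈ Ω ∧ 0 ≤ w x} from ⟨hx, hwx.le⟩), heq' x hx hwx,
          ← hexp x hwx]
        exact (tendsto_integral_cutoff hε hlim hwx).mul_const _
  refine tendsto_nhds_unique l1 (l2.congr fun n => ?_)
  exact (hw.green (continuous_cutoff _) (hε n) fun τ hτ => cutoff_eq_zero (hε n) hτ).symm

end IsDirichlet

theorem mul_exp_le_of_mul_le {a x x₀ m n : ℝ} (ha : 0 < a) (hx : 0 ≤ x) (hx₀ : 0 < x₀)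
    (hn : 0 ≤ n) (h : a * m ≤ x * (n - m)) :
    m * exp (a / (x₀ + a) - a / (x₀ + a) ^ 2 * (x - x₀)) ≤ n := by
  have hxa : 0 < x + a := by linarith
  have h₀ : 0 < x₀ + a := by linarith
  have htan : a / (x₀ + a) - a / (x₀ + a) ^ 2 * (x - x₀) ≤ a / (x + a) := by
    have : a / (x + a) - (a / (x₀ + a) - a / (x₀ + a) ^ 2 * (x - x₀))
        = a * (x - x₀) ^ 2 / ((x + a) * (x₀ + a) ^ 2) := by
      field_simp
      ring
    have h2 : 0 ≤ a * (x - x₀) ^ 2 / ((x + a) * (x₀ + a) ^ 2) := by positivity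
    linarith
  have hm : m ≤ (1 - a / (x + a)) * n := by
    have : (1 - a / (x + a)) * n = x * n / (x + a) := by
      field_simp
      ring
    rw [this, le_div_iff₀ hxa]
    linarith
  have he : 1 - a / (x + a) ≤ exp (-(a / (x + a))) := by
    linarith [Real.add_one_le_exp (-(a / (x + a)))]
  have hm2 : m ≤ exp (-(a / (x + a))) * n := hm.trans (mul_le_mul_of_nonneg_right he hn)
  calc _ ≤ exp (-(a / (x + a))) * n * exp (a / (x₀ + a) - a / (x₀ + a) ^ 2 * (x - x₀)) :=
        mul_le_mul_of_nonneg_right hm2 (exp_pos _).le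
    _ ≤ exp (-(a / (x + a))) * n * exp (a / (x + a)) := by gcongr
    _ = n := by
        rw [mul_right_comm, ← Real.exp_add]
        simp

namespace IsDirichlet

variable {Ω : Set R2} {w : R2 → ℝ} {p M : ℝ}

theorem distrib_le_of_partition (hw : IsDirichlet Ω w)
    (hint : IntegrableOn (fun x => ‖gradient w x‖ ^ 2) Ω) {T : ℝ} (hT : 0 < T) {D : ℝ}
    (hD : D = ∫ x in {x | x ∈ Ω ∧ 0 < w x}, ‖gradient w x‖ ^ 2) (hD0 : 0 < D) {n : ℕ}
    (hn : 0 < n) :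
    distrib Ω w T * exp (4 * π * T ^ 2 / (D + 4 * π * T ^ 2 / n)) ≤ volume.real Ω := by
  have hn' : (0 : ℝ) < n := by exact_mod_cast hn
  have mO : ∀ t, MeasurableSet {x | x ∈ Ω ∧ 0 < w x ∧ w x < t} := fun t =>
    (hw.continuousOn_self.isOpen_inter_preimage hw.isOpen isOpen_Ioo).measurableSet
  have mL : ∀ s t, MeasurableSet {x | x ∈ Ω ∧ s < w x ∧ w x < t} := fun s t =>
    (hw.continuousOn_self.isOpen_inter_preimage hw.isOpen isOpen_Ioo).measurableSet
  set E : ℝ → ℝ := fun t => ∫ x in {x | x ∈ Ω ∧ 0 < w x ∧ w x < t}, ‖gradient w x‖ ^ 2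
    with hE
  have hE0 : ∀ t, 0 ≤ E t := fun t => integral_nonneg fun x => sq_nonneg _
  have hED : ∀ t, E t ≤ D := fun t => by
    rw [hD]
    exact setIntegral_mono_set (hint.mono_set fun x hx => hx.1) (ae_of_all _ fun x => sq_nonneg _)
      (LE.le.eventuallyLE fun x hx => ⟨hx.1, hx.2.1⟩)
  have hEst : ∀ s t, 0 ≤ s → s ≤ t →
      ∫ x in {x | x ∈ Ω ∧ s < w x ∧ w x < t}, ‖gradient w x‖ ^ 2 ≤ E t - E s := by
    intro s t hs hst
    have hdisj : Disjoint {x | x ∈ Ω ∧ s < w x ∧ w x < t} {x | x ∈ Ω ∧ 0 < w x ∧ w x < s} :=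
      Set.disjoint_left.2 fun x hx hy => absurd hx.2.1 (not_lt.2 hy.2.2.le)
    have hu := setIntegral_union (f := fun x => ‖gradient w x‖ ^ 2) hdisj (mO s)
      (hint.mono_set fun x hx => hx.1) (hint.mono_set fun x hx => hx.1)
    have hle := setIntegral_mono_set (μ := volume) (f := fun x => ‖gradient w x‖ ^ 2)
      (s := {x | x ∈ Ω ∧ s < w x ∧ w x < t} ∪ {x | x ∈ Ω ∧ 0 < w x ∧ w x < s})
      (t := {x | x ∈ Ω ∧ 0 < w x ∧ w x < t})
      (hint.mono_set fun x hx => hx.1) (ae_of_all _ fun x => sq_nonneg _)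
      (LE.le.eventuallyLE fun x hx => by
        rcases hx with h | h
        · exact ⟨h.1, hs.trans_lt h.2.1, h.2.2⟩
        · exact ⟨h.1, h.2.1, h.2.2.trans_le hst⟩)
    rw [hu] at hle
    simp only [hE]
    linarith
  set d := T / n with hd
  set a := 4 * π * d ^ 2 with ha
  set x₀ := D / n with hx
  have hd0 : 0 < d := by positivity
  have ha0 : 0 < a := by positivity
  have hx0 : 0 < x₀ := by positivity
  set c := a / (x₀ + a) ^ 2 with hc
  have hc0 : 0 < c := by positivity
  have ind : ∀ k : ℕ, distrib Ω w (k * d) * exp (k * (a / (x₀ + a)) - c * (E (k * d) - k * x₀))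
      ≤ volume.real Ω := by
    intro k
    induction k with
    | zero =>
      have h1 : distrib Ω w (((0 : ℕ) : ℝ) * d) ≤ volume.real Ω :=
        measureReal_mono (fun x hx => hx.1) hw.volume_ne_top
      refine le_trans (mul_le_of_le_one_right (distrib_nonneg _) ?_) h1
      rw [Real.exp_le_one_iff]
      have := mul_nonneg hc0.le (hE0 (((0 : ℕ) : ℝ) * d))
      simp only [CharP.cast_eq_zero, zero_mul, sub_zero] at this ⊢
      linarith
    | succ k ih =>
      have hs : 0 ≤ (k : ℝ) * d := by positivity
      have hst : (k : ℝ) * d < ((k + 1 : ℕ) : ℝ) * d := by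
        push_cast
        nlinarith
      have hcap := hw.capacity_le hint hs hst
      have hsub : 0 ≤ distrib Ω w (k * d) - distrib Ω w (((k + 1 : ℕ) : ℝ) * d) :=
        sub_nonneg.2 (hw.distrib_antitone hst.le)
      have hstep := hcap.trans (mul_le_mul_of_nonneg_right (hEst _ _ hs hst.le) hsub)
      have hdd : ((k + 1 : ℕ) : ℝ) * d - k * d = d := by
        push_cast
        ring
      rw [hdd] at hstep
      have hx' : 0 ≤ E (((k + 1 : ℕ) : ℝ) * d) - E (k * d) :=
        (integral_nonneg fun x => sq_nonneg _).trans (hEst _ _ hs hst.le)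
      have h1 := mul_exp_le_of_mul_le (m := distrib Ω w (((k + 1 : ℕ) : ℝ) * d)) ha0 hx' hx0
        (distrib_nonneg (k * d)) (by rw [ha]; linarith)
      refine le_trans (le_of_eq ?_) ((mul_le_mul_of_nonneg_right h1 (exp_pos _).le).trans ih)
      rw [mul_assoc, ← Real.exp_add]
      congr 2
      push_cast
      ring
  have hfin := ind n
  have hnd : (n : ℝ) * d = T := by
    rw [hd]
    field_simp
  have hnx : (n : ℝ) * x₀ = D := by
    rw [hx]
    field_simp
  rw [hnd, hnx] at hfin
  refine le_trans (mul_le_mul_of_nonneg_left (Real.exp_le_exp.2 ?_) (distrib_nonneg _)) hfin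
  have e : 4 * π * T ^ 2 / (D + 4 * π * T ^ 2 / n) = n * (a / (x₀ + a)) := by
    rw [ha, hx, hd]
    field_simp
  rw [e]
  have := mul_nonneg hc0.le (sub_nonneg.2 (hED T))
  linarith

/-- Exponential decay of the distribution function. -/
theorem distrib_le_exp (hw : IsDirichlet Ω w)
    (hint : IntegrableOn (fun x => ‖gradient w x‖ ^ 2) Ω) {T : ℝ} (hT : 0 < T) {D : ℝ}
    (hD : D = ∫ x in {x | x ∈ Ω ∧ 0 < w x}, ‖gradient w x‖ ^ 2) (hD0 : 0 < D) :
    distrib Ω w T ≤ volume.real Ω * exp (-(4 * π * T ^ 2 / D)) := by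
  have hlim : Tendsto (fun n : ℕ => distrib Ω w T * exp (4 * π * T ^ 2 / (D + 4 * π * T ^ 2 / n)))
      atTop (𝓝 (distrib Ω w T * exp (4 * π * T ^ 2 / (D + 0)))) := by
    refine Tendsto.const_mul _ ((Real.continuous_exp.tendsto _).comp ?_)
    refine Tendsto.div tendsto_const_nhds (tendsto_const_nhds.add ?_) (by linarith)
    exact tendsto_const_div_atTop_nhds_zero_nat _
  have h := le_of_tendsto hlim (by
    filter_upwards [eventually_gt_atTop 0] with n hn
    exact hw.distrib_le_of_partition hint hT hD hD0 hn)
  rw [add_zero] at h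
  rw [Real.exp_neg, ← div_eq_mul_inv, le_div_iff₀ (exp_pos _)]
  exact h

end IsDirichlet

namespace IsDirichlet

variable {Ω : Set R2} {w : R2 → ℝ} {p M : ℝ}

theorem intervalIntegrable_rpow_mul_distrib (hw : IsDirichlet Ω w) (hp : 0 ≤ p) (a b : ℝ) :
    IntervalIntegrable (fun t => t ^ p * distrib Ω w t) volume a b :=
  (hw.distrib_antitone.intervalIntegrable).continuousOn_mul
    (Real.continuous_rpow_const hp).continuousOn

theorem massAbove_sub_eq (hw : IsDirichlet Ω w) (hp : 0 < p) (hM : ∀ x ∈ Ω, w x ≤ M) {s : ℝ}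
    (hs : 0 ≤ s) (hsM : s ≤ M) :
    massAbove Ω w (p + 1) s - s ^ (p + 1) * distrib Ω w s
      = (p + 1) * ∫ t in s..M, t ^ p * distrib Ω w t := by
  have hp1 : 0 < p + 1 := by linarith
  have mS := hw.measurableSet_superlevel s
  set ν := (volume : Measure R2).restrict {x | x ∈ Ω ∧ s ≤ w x} with hν
  have i1 : Integrable (fun x => w x ^ (p + 1)) ν :=
    hw.integrableOn_of_bound hM (φ := fun a => a ^ (p + 1)) (Real.continuous_rpow_const hp1.le)
  have hfin : IsFiniteMeasure ν := ⟨by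
    rw [hν, Measure.restrict_apply_univ]
    exact (hw.volume_superlevel_ne_top s).lt_top⟩
  have i2 : Integrable (fun x => w x ^ (p + 1) - s ^ (p + 1)) ν := i1.sub (integrable_const _)
  have hν1 : ν.real univ = distrib Ω w s := by
    rw [hν, measureReal_restrict_apply_univ]
    rfl
  have el : massAbove Ω w (p + 1) s - s ^ (p + 1) * distrib Ω w s
      = ∫ x, (w x ^ (p + 1) - s ^ (p + 1)) ∂ν := by
    rw [integral_sub i1 (integrable_const _), integral_const, hν1, smul_eq_mul,
      mul_comm (distrib Ω w s)]
    rfl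
  have hae : ∀ᵐ x ∂ν, s ≤ w x ∧ x ∈ Ω := by
    filter_upwards [ae_restrict_mem mS] with x hx using ⟨hx.2, hx.1⟩
  have hprim : ∀ b, s ≤ b → ∫ t in (0 : ℝ)..b - s, (p + 1) * (t + s) ^ p
      = b ^ (p + 1) - s ^ (p + 1) := by
    intro b hb
    rw [intervalIntegral.integral_const_mul,
      intervalIntegral.integral_comp_add_right (fun t => t ^ p) s, zero_add, sub_add_cancel,
      integral_rpow (Or.inl (by linarith))]
    field_simp
  have hg : Continuous fun t : ℝ => (p + 1) * (t + s) ^ p :=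
    continuous_const.mul ((Real.continuous_rpow_const hp.le).comp (by fun_prop))
  have hmeas : AEMeasurable (fun x => w x - s) ν :=
    (((hw.continuousOn_self.mono fun x hx => hx.1).aestronglyMeasurable mS).aemeasurable).sub
      aemeasurable_const
  have cake := lintegral_comp_eq_lintegral_meas_le_mul ν (f := fun x => w x - s)
    (g := fun t => (p + 1) * (t + s) ^ p)
    (by filter_upwards [hae] with x hx using sub_nonneg.2 hx.1) hmeas
    (fun t _ => hg.intervalIntegrable _ _)
    (by
      filter_upwards [ae_restrict_mem measurableSet_Ioi] with t ht
      exact mul_nonneg hp1.le (Real.rpow_nonneg (add_nonneg (le_of_lt ht) hs) _))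
  have hmono : 0 ≤ᵐ[ν] fun x => w x ^ (p + 1) - s ^ (p + 1) := by
    filter_upwards [hae] with x hx
    exact sub_nonneg.2 (Real.rpow_le_rpow hs hx.1 hp1.le)
  have c1 : ∫⁻ x, ENNReal.ofReal (∫ t in (0 : ℝ)..w x - s, (p + 1) * (t + s) ^ p) ∂ν
      = ENNReal.ofReal (massAbove Ω w (p + 1) s - s ^ (p + 1) * distrib Ω w s) := by
    rw [el, ofReal_integral_eq_lintegral_ofReal i2 hmono]
    refine lintegral_congr_ae ?_
    filter_upwards [hae] with x hx
    rw [hprim _ hx.1]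
  have hνt : ∀ t ∈ Ioi (0 : ℝ), ν {x | t ≤ w x - s} = ENNReal.ofReal (distrib Ω w (t + s)) := by
    intro t ht
    have h0 : (0 : ℝ) < t := ht
    rw [distrib, ofReal_measureReal (hw.volume_superlevel_ne_top _), hν,
      Measure.restrict_apply' mS]
    congr 1
    ext x
    simp only [mem_inter_iff, mem_ofPred_eq]
    constructor
    · rintro ⟨h, h1, h2⟩
      exact ⟨h1, by linarith⟩
    · rintro ⟨h, h1⟩
      exact ⟨by linarith, h, by linarith⟩
  have hzero : ∀ t, M < t → distrib Ω w t = 0 := by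
    intro t ht
    have : {x | x ∈ Ω ∧ t ≤ w x} = ∅ := by
      ext x
      simp only [mem_ofPred_eq, mem_empty_iff_false, iff_false, not_and, not_le]
      exact fun hx => (hM x hx).trans_lt ht
    rw [distrib, this]
    simp
  set G : ℝ → ℝ := fun t => (p + 1) * ((t + s) ^ p * distrib Ω w (t + s)) with hG
  have iG : IntervalIntegrable G volume 0 (M - s) := by
    refine IntervalIntegrable.const_mul ?_ _
    have := (hw.intervalIntegrable_rpow_mul_distrib hp.le s M).comp_add_right s
    simpa using this
  have iG' : IntegrableOn G (Ioc 0 (M - s)) :=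
    (intervalIntegrable_iff_integrableOn_Ioc_of_le (by linarith)).1 iG
  have c2 : ∫⁻ t in Ioi (0 : ℝ), ν {x | t ≤ w x - s} * ENNReal.ofReal ((p + 1) * (t + s) ^ p)
      = ENNReal.ofReal (∫ t in Ioc 0 (M - s), G t) := by
    have hG0 : 0 ≤ᵐ[volume.restrict (Ioc 0 (M - s))] G := by
      filter_upwards [ae_restrict_mem measurableSet_Ioc] with t ht
      exact mul_nonneg hp1.le (mul_nonneg (Real.rpow_nonneg (add_nonneg ht.1.le hs) _)
        (distrib_nonneg _))
    rw [ofReal_integral_eq_lintegral_ofReal iG' hG0, ← lintegral_indicator measurableSet_Ioi,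
      ← lintegral_indicator measurableSet_Ioc]
    refine lintegral_congr fun t => ?_
    by_cases ht : t ∈ Ioi (0 : ℝ)
    · have e : ν {x | t ≤ w x - s} * ENNReal.ofReal ((p + 1) * (t + s) ^ p)
          = ENNReal.ofReal (G t) := by
        rw [hνt t ht, ← ENNReal.ofReal_mul (distrib_nonneg _)]
        congr 1
        simp only [hG]
        ring
      rw [indicator_of_mem ht, e]
      by_cases ht2 : t ≤ M - s
      · rw [indicator_of_mem (show t ∈ Ioc 0 (M - s) from ⟨ht, ht2⟩)]
      · rw [indicator_of_notMem (fun h => ht2 h.2)]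
        simp [hG, hzero (t + s) (by linarith)]
    · rw [indicator_of_notMem ht, indicator_of_notMem (fun h => ht h.1)]
  have hL : 0 ≤ massAbove Ω w (p + 1) s - s ^ (p + 1) * distrib Ω w s := by
    rw [el]
    exact integral_nonneg_of_ae hmono
  have hR : 0 ≤ ∫ t in Ioc 0 (M - s), G t :=
    setIntegral_nonneg measurableSet_Ioc fun t ht => mul_nonneg hp1.le
      (mul_nonneg (Real.rpow_nonneg (add_nonneg ht.1.le hs) _) (distrib_nonneg _))
  rw [c1, c2, ENNReal.ofReal_eq_ofReal_iff hL hR] at cake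
  rw [cake, ← intervalIntegral.integral_of_le (by linarith), intervalIntegral.integral_const_mul,
    intervalIntegral.integral_comp_add_right (fun t => t ^ p * distrib Ω w t) s, zero_add,
    sub_add_cancel]

theorem massAbove_nonneg {s : ℝ} (hw : IsDirichlet Ω w) (hs : 0 ≤ s) : 0 ≤ massAbove Ω w p s :=
  setIntegral_nonneg (hw.measurableSet_superlevel s) fun _ hx => Real.rpow_nonneg (hs.trans hx.2) _

theorem integrableOn_rpow (hw : IsDirichlet Ω w) (hp : 0 < p) (hM : ∀ x ∈ Ω, w x ≤ M) (s : ℝ) :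
    IntegrableOn (fun x => w x ^ p) {x | x ∈ Ω ∧ s ≤ w x} :=
  hw.integrableOn_of_bound hM (φ := fun a => a ^ p) (Real.continuous_rpow_const hp.le)

theorem massAbove_antitoneOn (hw : IsDirichlet Ω w) (hp : 0 < p) (hM : ∀ x ∈ Ω, w x ≤ M) :
    AntitoneOn (massAbove Ω w p) (Ici 0) := by
  intro s hs t _ hst
  refine setIntegral_mono_set (hw.integrableOn_rpow hp hM s) ?_
    (LE.le.eventuallyLE fun x hx => ⟨hx.1, hst.trans hx.2⟩)
  filter_upwards [ae_restrict_mem (hw.measurableSet_superlevel s)] with x hx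
  exact Real.rpow_nonneg (le_trans hs hx.2) _

theorem rpow_mul_distrib_sub_le (hw : IsDirichlet Ω w) (hp : 0 < p) (hM : ∀ x ∈ Ω, w x ≤ M)
    {s t : ℝ} (hs : 0 ≤ s) (hst : s ≤ t) :
    s ^ p * (distrib Ω w s - distrib Ω w t) ≤ massAbove Ω w p s - massAbove Ω w p t := by
  have hsub : {x | x ∈ Ω ∧ t ≤ w x} ⊆ {x | x ∈ Ω ∧ s ≤ w x} := fun x hx => ⟨hx.1, hst.trans hx.2⟩
  have e : {x | x ∈ Ω ∧ s ≤ w x} \ {x | x ∈ Ω ∧ t ≤ w x} = {x | x ∈ Ω ∧ s ≤ w x ∧ w x < t} := by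
    ext x
    simp
    tauto
  have fl : volume {x | x ∈ Ω ∧ s ≤ w x ∧ w x < t} ≠ ⊤ :=
    ((measure_mono fun x hx => hx.1).trans_lt hw.volume_ne_top.lt_top).ne
  have := setIntegral_sdiff (hw.measurableSet_superlevel t) (hw.integrableOn_rpow hp hM s) hsub
  rw [massAbove, massAbove, ← this, e, hw.distrib_sub hst, mul_comm]
  rw [← smul_eq_mul, ← setIntegral_const]
  exact setIntegral_mono_on (integrableOn_const fl)
    ((hw.integrableOn_rpow hp hM s).mono_set fun x hx => ⟨hx.1, hx.2.1⟩)
    (hw.measurableSet_layer s t) fun x hx => Real.rpow_le_rpow hs hx.2.1 hp.le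

theorem mul_massAbove_le (hw : IsDirichlet Ω w) (hp : 0 < p) (hM : ∀ x ∈ Ω, w x ≤ M)
    {s : ℝ} (hs : 0 ≤ s) : s * massAbove Ω w p s ≤ massAbove Ω w (p + 1) s := by
  rw [massAbove, massAbove, ← integral_const_mul]
  refine setIntegral_mono_on ((hw.integrableOn_rpow hp hM s).const_mul s)
    (hw.integrableOn_rpow (by linarith) hM s) (hw.measurableSet_superlevel s) fun x hx => ?_
  rcases (hs.trans hx.2).eq_or_lt with h | h
  · rw [← h, Real.zero_rpow hp.ne', Real.zero_rpow (by linarith)]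
    simp
  · rw [Real.rpow_add_one h.ne', mul_comm]
    exact mul_le_mul_of_nonneg_left hx.2 (Real.rpow_nonneg h.le _)

theorem distrib_pos (hw : IsDirichlet Ω w) {x : R2} (hx : x ∈ Ω) {t : ℝ} (ht : t < w x) :
    0 < distrib Ω w t := by
  have hO := hw.continuousOn_self.isOpen_inter_preimage hw.isOpen (isOpen_Ioi (a := t))
  have : 0 < volume (Ω ∩ w ⁻¹' Ioi t) := hO.measure_pos _ ⟨x, hx, ht⟩
  have h2 : 0 < volume {x | x ∈ Ω ∧ t ≤ w x} :=
    this.trans_le (measure_mono fun y hy => ⟨hy.1, le_of_lt hy.2⟩)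
  exact ENNReal.toReal_pos h2.ne' (hw.volume_superlevel_ne_top t)

theorem rpow_mul_distrib_le (hw : IsDirichlet Ω w) (hp : 0 < p) (hM : ∀ x ∈ Ω, w x ≤ M)
    {s : ℝ} (hs : 0 ≤ s) : s ^ p * distrib Ω w s ≤ massAbove Ω w p s := by
  have fl := hw.volume_superlevel_ne_top s
  rw [mul_comm, distrib, ← smul_eq_mul, ← setIntegral_const]
  exact setIntegral_mono_on (integrableOn_const fl) (hw.integrableOn_rpow hp hM s)
    (hw.measurableSet_superlevel s) fun x hx => Real.rpow_le_rpow hs hx.2 hp.le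

end IsDirichlet

namespace IsDirichlet

variable {Ω : Set R2} {w : R2 → ℝ} {p M : ℝ}

theorem ae_le_neg_mul_deriv (hw : IsDirichlet Ω w) (hp : 0 < p)
    (heq : ∀ x ∈ Ω, -lap w x = |w x| ^ (p - 1) * w x) (hM : ∀ x ∈ Ω, w x ≤ M) :
    ∀ᵐ t : ℝ, 0 < t → DifferentiableAt ℝ (massAbove Ω w p) t ∧
      4 * π * (t ^ p * distrib Ω w t) ≤ -(massAbove Ω w p t * deriv (massAbove Ω w p) t) := by
  have hmono : MonotoneOn (fun t => -massAbove Ω w p t) (Ici 0) :=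
    (hw.massAbove_antitoneOn hp hM).neg
  filter_upwards [hmono.ae_differentiableWithinAt_of_mem] with t ht h0
  have hd : DifferentiableAt ℝ (massAbove Ω w p) t := by
    have := (ht h0.le).differentiableAt (Ici_mem_nhds h0)
    simpa using this.neg
  refine ⟨hd, ?_⟩
  have hs := (hasDerivAt_iff_tendsto_slope.1 hd.hasDerivAt).mono_left
    (nhdsWithin_mono t (fun s (hs : s < t) => hs.ne) : 𝓝[<] t ≤ 𝓝[≠] t)
  have hF : Tendsto (massAbove Ω w p) (𝓝[<] t) (𝓝 (massAbove Ω w p t)) :=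
    hd.continuousAt.tendsto.mono_left nhdsWithin_le_nhds
  have hl : Tendsto (fun s : ℝ => 4 * π * (s ^ p * distrib Ω w t)) (𝓝[<] t)
      (𝓝 (4 * π * (t ^ p * distrib Ω w t))) := by
    have : Continuous fun s : ℝ => 4 * π * (s ^ p * distrib Ω w t) :=
      continuous_const.mul ((Real.continuous_rpow_const hp.le).mul continuous_const)
    exact (this.tendsto t).mono_left nhdsWithin_le_nhds
  refine le_of_tendsto_of_tendsto hl (hF.mul hs).neg ?_
  filter_upwards [Ioo_mem_nhdsLT h0] with s hs
  have hst : 0 < t - s := sub_pos.2 hs.2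
  have h1 := hw.mass_le hp heq hM hs.1.le hs.2
  have h2 := hw.rpow_mul_distrib_sub_le hp hM hs.1.le hs.2.le
  have hF0 : 0 ≤ massAbove Ω w p s := hw.massAbove_nonneg hs.1.le
  have hsp : 0 ≤ s ^ p := Real.rpow_nonneg hs.1.le _
  have e : -(massAbove Ω w p s * slope (massAbove Ω w p) t s)
      = massAbove Ω w p s * (massAbove Ω w p s - massAbove Ω w p t) / (t - s) := by
    rw [slope_def_field, ← neg_sub t s, div_neg]
    ring
  rw [e, le_div_iff₀ hst]
  calc 4 * π * (s ^ p * distrib Ω w t) * (t - s) = s ^ p * (4 * π * distrib Ω w t * (t - s)) := by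
        ring
    _ ≤ s ^ p * (massAbove Ω w p s * (distrib Ω w s - distrib Ω w t)) := by gcongr
    _ = massAbove Ω w p s * (s ^ p * (distrib Ω w s - distrib Ω w t)) := by ring
    _ ≤ _ := by gcongr

theorem integral_le_massAbove_sq (hw : IsDirichlet Ω w) (hp : 0 < p)
    (heq : ∀ x ∈ Ω, -lap w x = |w x| ^ (p - 1) * w x) (hM : ∀ x ∈ Ω, w x ≤ M) {s : ℝ}
    (hs : 0 < s) (hsM : s ≤ M) :
    8 * π * ∫ t in s..M, t ^ p * distrib Ω w t ≤ massAbove Ω w p s ^ 2 := by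
  have hmono : MonotoneOn (fun t => -massAbove Ω w p t ^ 2) (uIcc s M) := by
    rw [uIcc_of_le hsM]
    intro a ha b hb hab
    have h1 := hw.massAbove_antitoneOn hp hM (hs.le.trans ha.1) (hs.le.trans hb.1) hab
    have h2 : 0 ≤ massAbove Ω w p b := hw.massAbove_nonneg (hs.le.trans hb.1)
    exact neg_le_neg (pow_le_pow_left₀ h2 h1 2)
  have hu := hmono.intervalIntegral_deriv_mem_uIcc
  have hle : massAbove Ω w p M ^ 2 ≤ massAbove Ω w p s ^ 2 := by
    have := hmono left_mem_uIcc right_mem_uIcc hsM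
    simpa using this
  rw [uIcc_of_le (by linarith)] at hu
  have h3 : ∫ t in s..M, 8 * π * (t ^ p * distrib Ω w t)
      ≤ ∫ t in s..M, deriv (fun t => -massAbove Ω w p t ^ 2) t := by
    refine intervalIntegral.integral_mono_ae_restrict hsM
      ((hw.intervalIntegrable_rpow_mul_distrib hp.le s M).const_mul _)
      hmono.intervalIntegrable_deriv ?_
    filter_upwards [ae_restrict_of_ae (hw.ae_le_neg_mul_deriv hp heq hM),
      ae_restrict_mem measurableSet_Icc] with t ht hmem
    obtain ⟨hd, hk⟩ := ht (hs.trans_le hmem.1)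
    have : deriv (fun t => -massAbove Ω w p t ^ 2) t
        = -(2 * massAbove Ω w p t * deriv (massAbove Ω w p) t) := by
      have h2 : HasDerivAt (fun t => -massAbove Ω w p t ^ 2)
        (-(((2 : ℕ) : ℝ) * massAbove Ω w p t ^ (2 - 1) * deriv (massAbove Ω w p) t)) t :=
        (hd.hasDerivAt.pow 2).neg
      rw [h2.deriv]
      simp
    rw [this]
    linarith
  rw [intervalIntegral.integral_const_mul] at h3
  have := sq_nonneg (massAbove Ω w p M)
  linarith [hu.2]

theorem mul_sub_le_massAbove (hw : IsDirichlet Ω w) (hp : 0 < p)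
    (heq : ∀ x ∈ Ω, -lap w x = |w x| ^ (p - 1) * w x) (hM : ∀ x ∈ Ω, w x ≤ M) {s δ : ℝ}
    (hs : 0 < s) (hsM : s ≤ M) (hpos : ∀ t ∈ Ioo s M, 0 < massAbove Ω w p t)
    (hδ : ∀ t ∈ Ioo s M, δ * massAbove Ω w p t ≤ t ^ p * distrib Ω w t) :
    4 * π * δ * (M - s) ≤ massAbove Ω w p s := by
  have hmono : MonotoneOn (fun t => -massAbove Ω w p t) (uIcc s M) := by
    rw [uIcc_of_le hsM]
    exact ((hw.massAbove_antitoneOn hp hM).mono fun t ht => hs.le.trans ht.1).neg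
  have hu := hmono.intervalIntegral_deriv_mem_uIcc
  have hle : massAbove Ω w p M ≤ massAbove Ω w p s := by
    have := hmono left_mem_uIcc right_mem_uIcc hsM
    simpa using this
  rw [uIcc_of_le (by linarith)] at hu
  have h3 : ∫ _ in s..M, 4 * π * δ ≤ ∫ t in s..M, deriv (fun t => -massAbove Ω w p t) t := by
    refine intervalIntegral.integral_mono_ae_restrict hsM intervalIntegrable_const
      hmono.intervalIntegrable_deriv ?_
    rw [← Measure.restrict_congr_set Ioo_ae_eq_Icc]
    filter_upwards [ae_restrict_of_ae (hw.ae_le_neg_mul_deriv hp heq hM),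
      ae_restrict_mem measurableSet_Ioo] with t ht hmem
    obtain ⟨hd, hk⟩ := ht (hs.trans hmem.1)
    have : deriv (fun t => -massAbove Ω w p t) t = -deriv (massAbove Ω w p) t :=
      hd.hasDerivAt.neg.deriv
    rw [this]
    refine le_of_mul_le_mul_left ?_ (hpos t hmem)
    have := mul_le_mul_of_nonneg_left (hδ t hmem) (by positivity : 0 ≤ 4 * π)
    linarith
  rw [intervalIntegral.integral_const, smul_eq_mul] at h3
  have h4 : 0 ≤ massAbove Ω w p M := hw.massAbove_nonneg (hs.le.trans hsM)
  linarith [hu.2]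

/-- Energy lower bounds in terms of the maximum value of `w`. -/
theorem le_massAbove_or_le (hw : IsDirichlet Ω w) (hp : 0 < p)
    (heq : ∀ x ∈ Ω, -lap w x = |w x| ^ (p - 1) * w x) (hM : ∀ x ∈ Ω, w x ≤ M)
    {x₀ : R2} (hx₀ : x₀ ∈ Ω) (hwx : w x₀ = M) {s δ : ℝ} (hs : 0 < s) (hsM : s < M)
    (hδ : δ ≤ 1) :
    4 * π * δ * (M - s) * s ≤ massAbove Ω w (p + 1) 0 ∨
      8 * π * (1 - δ) * s ^ 2 ≤ (p + 1) * massAbove Ω w (p + 1) 0 := by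
  have hp1 : 0 < p + 1 := by linarith
  have hpos : ∀ t ∈ Ioo s M, 0 < massAbove Ω w p t := fun t ht => by
    refine lt_of_lt_of_le ?_ (hw.rpow_mul_distrib_le hp hM (hs.trans ht.1).le)
    exact mul_pos (Real.rpow_pos_of_pos (hs.trans ht.1) _)
      (hw.distrib_pos hx₀ (by rw [hwx]; exact ht.2))
  have hE : ∀ t, 0 ≤ t → t * massAbove Ω w p t ≤ massAbove Ω w (p + 1) 0 := fun t ht =>
    (hw.mul_massAbove_le hp hM ht).trans
      (hw.massAbove_antitoneOn hp1 hM (mem_Ici.2 le_rfl) ht ht)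
  by_cases h : ∀ t ∈ Ioo s M, δ * massAbove Ω w p t ≤ t ^ p * distrib Ω w t
  · left
    have h1 := hw.mul_sub_le_massAbove hp heq hM hs hsM.le hpos h
    have h2 := mul_le_mul_of_nonneg_left h1 hs.le
    linarith [hE s hs.le]
  · right
    push Not at h
    obtain ⟨t, ht, hlt⟩ := h
    have ht0 : 0 < t := hs.trans ht.1
    have h1 := hw.integral_le_massAbove_sq hp heq hM ht0 ht.2.le
    have h2 := hw.massAbove_sub_eq hp hM ht0.le ht.2.le
    have h3 := hw.mul_massAbove_le hp hM ht0.le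
    have hF := hpos t ht
    rw [Real.rpow_add_one ht0.ne'] at h2
    have h4 : t * ((1 - δ) * massAbove Ω w p t)
        ≤ (p + 1) * ∫ τ in t..M, τ ^ p * distrib Ω w τ := by
      rw [← h2]
      nlinarith
    have h5 : massAbove Ω w p t * (8 * π * (1 - δ) * t)
        ≤ massAbove Ω w p t * ((p + 1) * massAbove Ω w p t) := by
      have h6 := mul_le_mul_of_nonneg_left h4 (by positivity : 0 ≤ 8 * π)
      have h7 := mul_le_mul_of_nonneg_left h1 hp1.le
      nlinarith
    have h8 := le_of_mul_le_mul_left h5 hF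
    have h9 := mul_le_mul_of_nonneg_left h8 ht0.le
    have h10 := mul_le_mul_of_nonneg_left (hE t ht0.le) hp1.le
    have h11 : 8 * π * (1 - δ) * s ^ 2 ≤ 8 * π * (1 - δ) * t ^ 2 := by
      have : 0 ≤ 1 - δ := by linarith
      have := ht.1.le
      gcongr
    linarith

/-- Energy upper bound obtained from the exponential decay of the distribution function. -/
theorem massAbove_le_of_bound (hw : IsDirichlet Ω w)
    (hint : IntegrableOn (fun x => ‖gradient w x‖ ^ 2) Ω) (hp : 0 < p) (hM : ∀ x ∈ Ω, w x ≤ M)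
    (hM0 : 0 ≤ M) {D : ℝ} (hD : D = ∫ x in {x | x ∈ Ω ∧ 0 < w x}, ‖gradient w x‖ ^ 2)
    (hD0 : 0 < D) {Q : ℝ}
    (hQ : ∀ t, 0 < t → t ≤ M → t ^ p * exp (-(4 * π * t ^ 2 / D)) ≤ Q) :
    massAbove Ω w (p + 1) 0 ≤ (p + 1) * (volume.real Ω * Q * M) := by
  have hp1 : 0 < p + 1 := by linarith
  have h := hw.massAbove_sub_eq hp hM le_rfl hM0
  rw [Real.zero_rpow hp1.ne', zero_mul, sub_zero] at h
  rw [h]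
  refine mul_le_mul_of_nonneg_left ?_ hp1.le
  have h2 : ∫ t in (0 : ℝ)..M, t ^ p * distrib Ω w t ≤ ∫ _ in (0 : ℝ)..M, volume.real Ω * Q := by
    refine intervalIntegral.integral_mono_on_of_le_Ioo hM0
      (hw.intervalIntegrable_rpow_mul_distrib hp.le 0 M) intervalIntegrable_const fun t ht => ?_
    have h3 := hw.distrib_le_exp hint ht.1 hD hD0
    have h4 := mul_le_mul_of_nonneg_left h3 (Real.rpow_nonneg ht.1.le p)
    have h5 := mul_le_mul_of_nonneg_left (hQ t ht.1 ht.2.le)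
      (measureReal_nonneg : 0 ≤ volume.real Ω)
    linarith
  rw [intervalIntegral.integral_const, smul_eq_mul, sub_zero] at h2
  linarith

theorem massAbove_pos (hw : IsDirichlet Ω w) (hp : 0 < p) (hM : ∀ x ∈ Ω, w x ≤ M) {x : R2}
    (hx : x ∈ Ω) (hwx : 0 < w x) : 0 < massAbove Ω w p 0 := by
  have h1 := hw.rpow_mul_distrib_le hp hM (half_pos hwx).le
  have h2 := hw.massAbove_antitoneOn hp hM (mem_Ici.2 le_rfl) (half_pos hwx).le (half_pos hwx).le
  have h3 := mul_pos (Real.rpow_pos_of_pos (half_pos hwx) p)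
    (hw.distrib_pos hx (half_lt_self hwx))
  linarith

end IsDirichlet

/-- The inequalities relating the maximum `M` and the energy `E` of a positive part, in a domain
of measure `V`. -/
structure LevelBounds (V p M E : ℝ) : Prop where
  pos_max : 0 < M
  pos_energy : 0 < E
  dichotomy : ∀ s δ : ℝ, 0 < s → s < M → δ ≤ 1 →
    4 * π * δ * (M - s) * s ≤ E ∨ 8 * π * (1 - δ) * s ^ 2 ≤ (p + 1) * E
  decay : ∀ Q : ℝ, (∀ t, 0 < t → t ≤ M → t ^ p * exp (-(4 * π * t ^ 2 / E)) ≤ Q) →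
    E ≤ (p + 1) * (V * Q * M)

theorem tendsto_mul_rpow_half {ρ : ℝ} (h0 : 0 < ρ) (h1 : ρ < 1) (K : ℝ) :
    Tendsto (fun p : ℝ => K * (p * (p + 1) * ρ ^ (p / 2))) atTop (𝓝 0) := by
  have hb : 0 < -log ρ / 2 := by linarith [Real.log_neg h0 h1]
  have h := ((tendsto_rpow_mul_exp_neg_mul_atTop_nhds_zero 2 _ hb).add
    (tendsto_rpow_mul_exp_neg_mul_atTop_nhds_zero 1 _ hb)).const_mul K
  simp only [add_zero, mul_zero] at h
  refine h.congr fun p => ?_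
  rw [Real.rpow_def_of_pos h0, Real.rpow_two, Real.rpow_one,
    show -(-log ρ / 2) * p = log ρ * (p / 2) by ring]
  ring

theorem rpow_mul_exp_eq {p t E : ℝ} (hp : 0 < p) (ht : 0 < t) :
    t ^ p * exp (-(4 * π * t ^ 2 / E)) = (t ^ 2 * exp (-(8 * π * t ^ 2 / (p * E)))) ^ (p / 2) := by
  rw [Real.mul_rpow (by positivity) (exp_pos _).le, ← Real.rpow_natCast, ← Real.rpow_mul ht.le,
    ← Real.exp_mul]
  congr 2
  · push_cast
    ring
  · by_cases hE : E = 0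
    · simp [hE]
    · field_simp
      ring

namespace LevelBounds

variable {V : ℝ} {M E : ℝ → ℝ}

theorem sq_le (h : ∀ᶠ p in atTop, LevelBounds V p (M p) (E p)) {C κ : ℝ} (hC : 0 < C)
    (hE : ∀ᶠ p in atTop, p * E p ≤ C) (hκ : C < 8 * π * κ) (hκ1 : 1 ≤ κ) :
    ∀ᶠ p in atTop, M p ^ 2 ≤ κ := by
  have hπ := pi_pos
  have hκ0 : 0 < κ := by linarith
  obtain ⟨δ, hδ0, hδ1, hδ⟩ : ∃ δ : ℝ, 0 < δ ∧ δ ≤ 1 ∧ C < 8 * π * (1 - δ) * κ := by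
    refine ⟨(8 * π * κ - C) / (2 * (8 * π * κ)), div_pos (by linarith) (by positivity), ?_, ?_⟩
    · rw [div_le_one (by positivity)]
      linarith
    · field_simp
      linarith
  obtain ⟨S, hS0, hS⟩ : ∃ S : ℝ, 0 < S ∧ C < 2 * π * δ * S := by
    refine ⟨C / (2 * π * δ) + 1, by positivity, ?_⟩
    field_simp
    nlinarith [mul_pos hπ hδ0]
  have l1 : Tendsto (fun p : ℝ => C * (1 + p⁻¹)) atTop (𝓝 C) := by
    simpa using (tendsto_inv_atTop_zero.const_add (1 : ℝ)).const_mul C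
  have l2 : Tendsto (fun p : ℝ => 8 * π * (1 - δ) * (κ * (1 - S * p⁻¹) ^ 2)) atTop
      (𝓝 (8 * π * (1 - δ) * κ)) := by
    simpa using ((((tendsto_inv_atTop_zero.const_mul S).const_sub (1 : ℝ)).pow 2).const_mul
      κ).const_mul (8 * π * (1 - δ))
  filter_upwards [h, hE, l1.eventually_lt l2 hδ, eventually_gt_atTop (2 * S),
    eventually_gt_atTop 0] with p hp hEp hlt hpS hp0
  by_contra hcon
  push Not at hcon
  have hM0 := hp.pos_max
  have hM2 : 1 ≤ M p ^ 2 := by linarith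
  set z := S * p⁻¹ with hz
  have hzp : z * p = S := by
    rw [hz]
    field_simp
  have hz0 : 0 < z := by positivity
  have hz1 : z < 1 / 2 := by
    rw [hz, ← div_eq_mul_inv, div_lt_iff₀ hp0]
    linarith
  rcases hp.dichotomy (M p * (1 - z)) δ (mul_pos hM0 (by linarith)) (by nlinarith) hδ1 with h1 | h1
  · have h2 := mul_le_mul_of_nonneg_left h1 hp0.le
    have e : p * (4 * π * δ * (M p - M p * (1 - z)) * (M p * (1 - z)))
        = 4 * π * δ * (z * p) * (1 - z) * M p ^ 2 := by ring
    rw [e, hzp] at h2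
    have h3 : 2 * π * δ * S * 1 ≤ 4 * π * δ * S * (1 - z) * M p ^ 2 := by
      refine mul_le_mul ?_ hM2 zero_le_one ?_
      · have : 0 ≤ π * δ * S := by positivity
        nlinarith
      · have : 0 ≤ 1 - z := by linarith
        positivity
    linarith
  · have h2 : 8 * π * (1 - δ) * (κ * (1 - z) ^ 2) ≤ 8 * π * (1 - δ) * (M p * (1 - z)) ^ 2 := by
      rw [mul_pow]
      have : 0 ≤ 1 - δ := by linarith
      gcongr
    have h3 : (p + 1) * E p ≤ C * (1 + p⁻¹) := by
      have : (p + 1) * E p = p * E p * (1 + p⁻¹) := by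
        field_simp
      rw [this]
      gcongr
    linarith

theorem lt_mul_energy (h : ∀ᶠ p in atTop, LevelBounds V p (M p) (E p)) (hV : 0 ≤ V) {B c : ℝ}
    (hB : ∀ᶠ p in atTop, M p ≤ B) (hc0 : 0 < c) (hc : c < 8 * π * exp 1) :
    ∀ᶠ p in atTop, c < p * E p := by
  have hπ := pi_pos
  have he := exp_pos 1
  set ρ := c / (8 * π * exp 1) with hρ
  have hρ0 : 0 < ρ := by positivity
  have hρ1 : ρ < 1 := (div_lt_one (by positivity)).2 hc
  have hl := tendsto_mul_rpow_half hρ0 hρ1 (V * B / ρ)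
  filter_upwards [h, hB, hl.eventually_lt_const (show (0 : ℝ) < 8 * π * exp 1 by positivity),
    eventually_gt_atTop 2] with p hp hMB hlt hp2
  by_contra hcon
  push Not at hcon
  have hp0 : 0 < p := by linarith
  have hE0 := hp.pos_energy
  set r := p * E p / (8 * π * exp 1) with hr
  have hr0 : 0 < r := by positivity
  have hrρ : r ≤ ρ := by
    rw [hr, hρ]
    gcongr
  have hQ : ∀ t, 0 < t → t ≤ M p → t ^ p * exp (-(4 * π * t ^ 2 / E p)) ≤ r ^ (p / 2) := by
    intro t ht _
    rw [rpow_mul_exp_eq hp0 ht]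
    refine Real.rpow_le_rpow (by positivity) ?_ (by positivity)
    set y := 8 * π * t ^ 2 / (p * E p) with hy
    have h1 : y ≤ exp (y - 1) := by linarith [Real.add_one_le_exp (y - 1)]
    have h2 : t ^ 2 = y * (p * E p / (8 * π)) := by
      rw [hy]
      field_simp
    have h3 : r = p * E p / (8 * π) * exp (-1) := by
      rw [hr, Real.exp_neg]
      field_simp
    calc t ^ 2 * exp (-y) = p * E p / (8 * π) * (y * exp (-y)) := by
          rw [h2]
          ring
      _ ≤ p * E p / (8 * π) * (exp (y - 1) * exp (-y)) := by gcongr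
      _ = r := by
          rw [← Real.exp_add, h3]
          ring_nf
  have h1 := hp.decay _ hQ
  have h2 : E p = 8 * π * exp 1 * r / p := by
    rw [hr]
    field_simp
  have h3 : r ^ (p / 2) = r * r ^ (p / 2 - 1) := by
    rw [Real.rpow_sub_one hr0.ne']
    field_simp
  have h4 : r ^ (p / 2 - 1) ≤ ρ ^ (p / 2) / ρ := by
    rw [← Real.rpow_sub_one hρ0.ne']
    exact Real.rpow_le_rpow hr0.le hrρ (by linarith)
  have h5 : (p + 1) * (V * r ^ (p / 2) * M p) ≤ (p + 1) * (V * (r * (ρ ^ (p / 2) / ρ)) * B) := by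
    rw [h3]
    have := hp.pos_max.le
    gcongr
  have h6 := h1.trans h5
  rw [h2, div_le_iff₀ hp0] at h6
  have h7 : r * (8 * π * exp 1) ≤ r * (V * B / ρ * (p * (p + 1) * ρ ^ (p / 2))) := by
    refine le_trans (by linarith) (h6.trans (le_of_eq ?_))
    field_simp
  have h8 := le_of_mul_le_mul_left h7 hr0
  linarith

theorem lt_max (h : ∀ᶠ p in atTop, LevelBounds V p (M p) (E p)) (hV : 0 ≤ V)
    {c : ℝ} (hc0 : 0 < c) (hc : ∀ᶠ p in atTop, c < p * E p)
    (hC : ∀ C, 8 * π * exp 1 < C → ∀ᶠ p in atTop, p * E p ≤ C) {m : ℝ} (hm0 : 0 < m)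
    (hm : m ^ 2 < exp 1) : ∀ᶠ p in atTop, m < M p := by
  have hπ := pi_pos
  have he := exp_pos 1
  set z := m ^ 2 with hz
  have hz0 : 0 < z := by positivity
  have hlt : z * exp (-(z / exp 1)) < 1 := by
    have h1 : z / exp 1 - 1 ≠ 0 := by
      have := (div_lt_one he).2 hm
      linarith
    have h2 := Real.add_one_lt_exp h1
    have h3 : z / exp 1 < exp (z / exp 1 - 1) := by linarith
    rw [Real.exp_sub, div_lt_div_iff_of_pos_right he] at h3
    rw [Real.exp_neg, ← div_eq_mul_inv, div_lt_one (exp_pos _)]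
    exact h3
  have hcont : Tendsto (fun a : ℝ => z * exp (-(z / a))) (𝓝[>] exp 1)
      (𝓝 (z * exp (-(z / exp 1)))) := by
    refine tendsto_nhdsWithin_of_tendsto_nhds (Tendsto.const_mul _
      ((Real.continuous_exp.tendsto _).comp (Tendsto.neg ?_)))
    exact tendsto_const_nhds.div tendsto_id he.ne'
  obtain ⟨a, haq, hae⟩ := ((hcont.eventually_lt_const hlt).and self_mem_nhdsWithin).exists
  have hae' : exp 1 < a := hae
  have ha0 : 0 < a := he.trans hae'
  set q := z * exp (-(z / a)) with hq
  have hq0 : 0 < q := by positivity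
  have hl := tendsto_mul_rpow_half hq0 haq (V * m)
  filter_upwards [h, hc, hC (8 * π * a) (by gcongr), hl.eventually_lt_const hc0,
    eventually_gt_atTop 0] with p hp hcp hCp hlp hp0
  by_contra hcon
  push Not at hcon
  have hE0 := hp.pos_energy
  have hQ : ∀ t, 0 < t → t ≤ M p → t ^ p * exp (-(4 * π * t ^ 2 / E p)) ≤ q ^ (p / 2) := by
    intro t ht htM
    rw [rpow_mul_exp_eq hp0 ht]
    refine Real.rpow_le_rpow (by positivity) ?_ (by positivity)
    have hy : t ^ 2 ≤ z := pow_le_pow_left₀ ht.le (htM.trans hcon) 2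
    set y := t ^ 2
    have hy0 : 0 < y := by positivity
    have h1 : y / a ≤ 8 * π * y / (p * E p) := by
      rw [div_le_div_iff₀ ha0 (by positivity)]
      nlinarith
    have h2 : y ≤ z * exp ((y - z) / a) := by
      have h3 : 1 + (y - z) / z ≤ 1 + (y - z) / a := by
        have h4 : (z - y) / a ≤ (z - y) / z := by
          have : 0 ≤ z - y := by linarith
          gcongr
          linarith
        rw [← neg_sub z y, neg_div, neg_div]
        linarith
      have h5 := h3.trans (by linarith [Real.add_one_le_exp ((y - z) / a)] :
        1 + (y - z) / a ≤ exp ((y - z) / a))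
      calc y = z * (1 + (y - z) / z) := by
            field_simp
            ring
        _ ≤ _ := by gcongr
    calc y * exp (-(8 * π * y / (p * E p))) ≤ (z * exp ((y - z) / a)) * exp (-(y / a)) := by
          gcongr
      _ = q := by
          rw [mul_assoc, ← Real.exp_add, hq]
          congr 2
          ring
  have h1 := hp.decay _ hQ
  have h2 : p * E p ≤ V * m * (p * (p + 1) * q ^ (p / 2)) := by
    have h3 : E p ≤ (p + 1) * (V * q ^ (p / 2) * m) := h1.trans (by gcongr)
    have h4 := mul_le_mul_of_nonneg_left h3 hp0.le
    linarith
  linarith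

/-- Two families of level bounds with total energy at most `16πe / p` asymptotically: both
maxima converge to `√e`. -/
theorem tendsto_max {M' E' L : ℝ → ℝ} (h : ∀ᶠ p in atTop, LevelBounds V p (M p) (E p))
    (h' : ∀ᶠ p in atTop, LevelBounds V p (M' p) (E' p)) (hV : 0 ≤ V)
    (hL : Tendsto L atTop (𝓝 (16 * π * exp 1)))
    (hle : ∀ᶠ p in atTop, p * (E p + E' p) ≤ L p) :
    Tendsto M atTop (𝓝 (exp (1 / 2))) := by
  have hπ := pi_pos
  have he := exp_pos 1
  have he1 : 1 < exp 1 := by simp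
  have hbig : ∀ᶠ p in atTop, p * (E p + E' p) ≤ 17 * π * exp 1 := by
    filter_upwards [hle, hL.eventually_lt_const (show 16 * π * exp 1 < 17 * π * exp 1 by
      nlinarith [mul_pos hπ he])] with p h1 h2 using h1.trans h2.le
  have low : ∀ {N F G : ℝ → ℝ}, (∀ᶠ p in atTop, LevelBounds V p (N p) (F p)) →
      (∀ᶠ p in atTop, 0 < G p) → (∀ᶠ p in atTop, p * (F p + G p) ≤ 17 * π * exp 1) →
      ∀ c, 0 < c → c < 8 * π * exp 1 → ∀ᶠ p in atTop, c < p * F p := by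
    intro N F G hN hG hFG c hc0 hc
    have h1 : ∀ᶠ p in atTop, p * F p ≤ 17 * π * exp 1 := by
      filter_upwards [hG, hFG, eventually_gt_atTop 0] with p a b hp
      have := mul_pos hp a
      linarith
    have h2 := sq_le hN (κ := 3 * exp 1) (by positivity) h1 (by nlinarith [mul_pos hπ he])
      (by linarith)
    refine lt_mul_energy hN hV (B := 3 * exp 1) ?_ hc0 hc
    filter_upwards [h2] with p hp
    nlinarith
  have hc := low h (h'.mono fun p a => a.pos_energy) hbig
  have hc' := low h' (h.mono fun p a => a.pos_energy)
    (hbig.mono fun p a => by rwa [add_comm])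
  have hC : ∀ C, 8 * π * exp 1 < C → ∀ᶠ p in atTop, p * E p ≤ C := by
    intro C hC
    have hπe := mul_pos hπ he
    set η := min ((C - 8 * π * exp 1) / 2) (π * exp 1) with hη
    have hη0 : 0 < η := lt_min (by linarith) hπe
    have hη1 : η ≤ (C - 8 * π * exp 1) / 2 := min_le_left _ _
    have hη2 : η ≤ π * exp 1 := min_le_right _ _
    filter_upwards [hc' (8 * π * exp 1 - η) (by linarith) (by linarith), hle,
      hL.eventually_lt_const (show 16 * π * exp 1 < 16 * π * exp 1 + η by linarith)]
      with p h1 h2 h3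
    linarith
  have hsqrt : exp (1 / 2) ^ 2 = exp 1 := by
    rw [← Real.exp_nat_mul]
    norm_num
  have hs0 := exp_pos (1 / 2)
  refine tendsto_order.2 ⟨fun m hm => ?_, fun m hm => ?_⟩
  · rcases le_or_gt m 0 with hm0 | hm0
    · exact h.mono fun p a => hm0.trans_lt a.pos_max
    · refine lt_max h hV (c := π * exp 1) (by positivity)
        (hc _ (by positivity) (by nlinarith [mul_pos hπ he])) hC hm0 ?_
      rw [← hsqrt]
      exact pow_lt_pow_left₀ hm hm0.le two_ne_zero
  · have hm2 : exp 1 < m ^ 2 := by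
      rw [← hsqrt]
      exact pow_lt_pow_left₀ hm hs0.le two_ne_zero
    set κ := (exp 1 + m ^ 2) / 2 with hκ
    have hκ1 : exp 1 < κ := by linarith
    set C := 8 * π * ((exp 1 + κ) / 2) with hCd
    have hC1 : 8 * π * exp 1 < C := by
      rw [hCd]
      gcongr
      linarith
    have hC2 : C < 8 * π * κ := by
      rw [hCd]
      gcongr
      linarith
    filter_upwards [sq_le h (by linarith [mul_pos hπ he]) (hC C hC1) hC2 (by linarith)] with p hp
    refine lt_of_pow_lt_pow_left₀ 2 (by linarith) ?_
    linarith

end LevelBounds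

theorem lap_neg (u : R2 → ℝ) (x : R2) : lap (fun y => -u y) x = -lap u x := by
  simp only [lap, fderiv_fun_neg, neg_apply, Finset.sum_neg_distrib]

theorem norm_gradient_neg (u : R2 → ℝ) (x : R2) :
    ‖gradient (fun y => -u y) x‖ = ‖gradient u x‖ := by
  rw [norm_gradient_eq, norm_gradient_eq, fderiv_fun_neg, norm_neg]

namespace IsSolution

variable {Ω : Set R2} {p : ℝ} {u : R2 → ℝ}

theorem neg (h : IsSolution Ω p u) : IsSolution Ω p (fun x => -u x) := by
  obtain ⟨h1, h2, h3, h4⟩ := h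
  refine ⟨h1.neg, h2.neg, fun x hx => ?_, fun x hx => by simp [h4 x hx]⟩
  rw [lap_neg, abs_neg, h3 x hx]
  ring

theorem isDirichlet (h : IsSolution Ω p u) (hop : IsOpen Ω) (hbdd : Bornology.IsBounded Ω) :
    IsDirichlet Ω u :=
  ⟨hop, hbdd, h.1, h.2.1.continuousOn, h.2.2.2⟩

theorem levelBounds (h : IsSolution Ω p u) (hop : IsOpen Ω) (hbdd : Bornology.IsBounded Ω)
    (hp : 1 < p) (hint : IntegrableOn (fun x => ‖gradient u x‖ ^ 2) Ω) {x₀ : R2} (hx₀ : x₀ ∈ Ω)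
    (hmax : ∀ x ∈ Ω, u x ≤ u x₀) (hpos : 0 < u x₀) :
    LevelBounds (volume.real Ω) p (u x₀)
      (∫ x in {x | x ∈ Ω ∧ 0 < u x}, ‖gradient u x‖ ^ 2) := by
  have hw := h.isDirichlet hop hbdd
  have hp0 : 0 < p := by linarith
  have hE := hw.energy_identity hint hp0 h.2.2.1 hmax
  have hE0 := hw.massAbove_pos (p := p + 1) (by linarith) hmax hx₀ hpos
  refine ⟨hpos, by rwa [hE], fun s δ hs hsM hδ => ?_, fun Q hQ => ?_⟩
  · rw [hE]
    exact hw.le_massAbove_or_le hp0 h.2.2.1 hmax hx₀ rfl hs hsM hδ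
  · have := hw.massAbove_le_of_bound hint hp0 hmax hpos.le rfl (by rwa [hE]) hQ
    rwa [← hE] at this

end IsSolution

theorem setIntegral_pos_add_neg_le {Ω : Set R2} {u : R2 → ℝ} (hop : IsOpen Ω)
    (hu : ContinuousOn u Ω) {f : R2 → ℝ} (hf : ∀ x, 0 ≤ f x) (hint : IntegrableOn f Ω) :
    (∫ x in {x | x ∈ Ω ∧ 0 < u x}, f x) + (∫ x in {x | x ∈ Ω ∧ 0 < -u x}, f x)
      ≤ ∫ x in Ω, f x := by
  have hm : MeasurableSet {x | x ∈ Ω ∧ 0 < -u x} :=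
    (hu.neg.isOpen_inter_preimage hop isOpen_Ioi).measurableSet
  have hd : Disjoint {x | x ∈ Ω ∧ 0 < u x} {x | x ∈ Ω ∧ 0 < -u x} :=
    Set.disjoint_left.2 fun x hx hy => by linarith [hx.2, hy.2]
  rw [← setIntegral_union hd hm (hint.mono_set fun x hx => hx.1)
    (hint.mono_set fun x hx => hx.1)]
  exact setIntegral_mono_set hint (ae_of_all _ hf)
    (LE.le.eventuallyLE (union_subset (fun x hx => hx.1) fun x hx => hx.1))

theorem stmt17
    (Ω : Set R2) (hne : Ω.Nonempty) (hop : IsOpen Ω)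
    (hbdd : Bornology.IsBounded Ω) (hconn : IsConnected Ω) (hsm : SmoothBoundary Ω)
    (u : ℝ → R2 → ℝ)
    (hsol : ∀ p > (1:ℝ), IsSolution Ω p (u p))
    (hnod : ∀ p > (1:ℝ), IsNodal Ω (u p))
    (xp xm : ℝ → R2)
    (hxpmem : ∀ p > (1:ℝ), xp p ∈ Ω)
    (hxpmax : ∀ p > (1:ℝ), ∀ x ∈ Ω, u p x ≤ u p (xp p))
    (hxmmem : ∀ p > (1:ℝ), xm p ∈ Ω)
    (hxmmin : ∀ p > (1:ℝ), ∀ x ∈ Ω, u p (xm p) ≤ u p x)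
    (hcomp : ∀ p > (1:ℝ), -u p (xm p) ≤ u p (xp p))
    (hA : CondA Ω u) (hM : MorseOne Ω u) :
    Tendsto (fun p : ℝ => u p (xp p)) atTop (𝓝 (Real.exp (1 / 2))) ∧
    (CondB u xp xm →
      Tendsto (fun p : ℝ => -u p (xm p)) atTop (𝓝 (Real.exp (1 / 2)))) := by
  have hint : ∀ᶠ p in atTop, IntegrableOn (fun x => ‖gradient (u p) x‖ ^ 2) Ω := by
    have hlim : (0 : ℝ) < 16 * π * Real.exp 1 := by positivity
    filter_upwards [hA.eventually_const_lt hlim] with p hp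
    by_contra hcon
    rw [integral_undef hcon, mul_zero] at hp
    exact lt_irrefl _ hp
  have hp1 : ∀ᶠ p : ℝ in atTop, 1 < p := eventually_gt_atTop 1
  have h : ∀ᶠ p in atTop, LevelBounds (volume.real Ω) p (u p (xp p))
      (∫ x in {x | x ∈ Ω ∧ 0 < u p x}, ‖gradient (u p) x‖ ^ 2) := by
    filter_upwards [hint, hp1] with p hi hp
    obtain ⟨x, hx, hux⟩ := (hnod p hp).1
    exact (hsol p hp).levelBounds hop hbdd hp hi (hxpmem p hp) (hxpmax p hp)
      (hux.trans_le (hxpmax p hp x hx))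
  have h' : ∀ᶠ p in atTop, LevelBounds (volume.real Ω) p (-u p (xm p))
      (∫ x in {x | x ∈ Ω ∧ 0 < -u p x}, ‖gradient (u p) x‖ ^ 2) := by
    filter_upwards [hint, hp1] with p hi hp
    obtain ⟨x, hx, hux⟩ := (hnod p hp).2
    have := (hsol p hp).neg.levelBounds hop hbdd hp (by simpa only [norm_gradient_neg] using hi)
      (hxmmem p hp) (fun y hy => neg_le_neg (hxmmin p hp y hy))
      (by linarith [hxmmin p hp x hx])
    simpa only [norm_gradient_neg] using this
  have hle : ∀ᶠ p in atTop, p * ((∫ x in {x | x ∈ Ω ∧ 0 < u p x}, ‖gradient (u p) x‖ ^ 2)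
      + ∫ x in {x | x ∈ Ω ∧ 0 < -u p x}, ‖gradient (u p) x‖ ^ 2)
      ≤ p * ∫ x in Ω, ‖gradient (u p) x‖ ^ 2 := by
    filter_upwards [hint, hp1] with p hi hp
    exact mul_le_mul_of_nonneg_left (setIntegral_pos_add_neg_le hop (hsol p hp).1.continuousOn
      (fun x => sq_nonneg _) hi) (by linarith)
  refine ⟨LevelBounds.tendsto_max h h' measureReal_nonneg hA hle, fun _ => ?_⟩
  exact LevelBounds.tendsto_max h' h measureReal_nonneg hA
    (hle.mono fun p hp => by rwa [add_comm] at hp)
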